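/- Let ℓ be a prime not dividing q, write (q+1)_ℓ and (q+1)_{ℓ'} for the ℓ-part and the ℓ'-part of q + 1, and let R = {g ∈ GU_n(q) : det(g)^{(q+1)_{ℓ'}} = 1}. Let h ∈ GU_n(q) have order coprime to ℓ, and let h = su = us be its multiplicative Jordan decomposition, with s semisimple (order coprime to p) and u unipotent; then s, u ∈ GU_n(q). For each eigenvalue ξ ∈ K of s, let λ^ξ be the Jordan type of the restriction of u to the eigenspace ker(s − ξ) ⊆ K^n. Then h ∈ R, and the ratio of the cardinality of the conjugacy class of h in GU_n(q) to the cardinality of the conjugacy class of h in R equals the greatest common divisor of (q+1)_ℓ together with all the parts of all the partitions λ^ξ, where ξ ranges over the eigenvalues of s. -/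

import Mathlib

open Module Matrix

/-- The permutation matrix `w₀` of the permutation `(1 n)(2 (n-1))⋯` of `{1, …, n}`. -/
def w0Mat (n : ℕ) (R : Type*) [CommRing R] : Matrix (Fin n) (Fin n) R :=
  Matrix.of fun i j => if j = Fin.rev i then 1 else 0

/-- Membership in the finite general unitary group
`GU_n(q) = {g ∈ GL_n(𝔽_{q²}) : w₀ · ((g^{(q)})ᵀ)⁻¹ · w₀ = g}`, where `g^{(q)}` is obtained
from `g` by raising every entry to the `q`-th power. -/
def IsGU {n : ℕ} (q : ℕ) {F2 : Type*} [Field F2] [Fintype F2] (g : GL (Fin n) F2) : Prop :=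
  w0Mat n F2 * ((((g : Matrix (Fin n) (Fin n) F2).map (· ^ q))ᵀ)⁻¹) * w0Mat n F2
    = (g : Matrix (Fin n) (Fin n) F2)

/-- The `K`-linear endomorphism of `K^n` attached to a matrix `g ∈ GL_n(F)`, where `K` is an
extension of `F`: extend scalars entrywise and act on column vectors. -/
noncomputable def glToEnd {n : ℕ} {F K : Type*} [Field F] [Field K] [Algebra F K]
    (g : GL (Fin n) F) : Module.End K (Fin n → K) :=
  Matrix.toLin' ((g : Matrix (Fin n) (Fin n) F).map (algebraMap F K))

section Jordan

variable {K V : Type*} [Field K] [AddCommGroup V] [Module K V] [FiniteDimensional K V]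

/-- Rank-nullity for the images of a subspace under consecutive powers. -/
lemma finrank_map_pow_eq (N : End K V) (U : Submodule K V) (j : ℕ) :
    finrank K (U.map (N ^ j)) =
      finrank K (LinearMap.ker N ⊓ U.map (N ^ j) : Submodule K V) +
        finrank K (U.map (N ^ (j + 1))) := by
  have h := (N.domRestrict (U.map (N ^ j))).finrank_range_add_finrank_ker
  have h1 : LinearMap.range (N.domRestrict (U.map (N ^ j))) = U.map (N ^ (j + 1)) := by
    rw [LinearMap.range_domRestrict, ← Submodule.map_comp, pow_succ']
    rfl
  have h2 : finrank K (LinearMap.ker (N.domRestrict (U.map (N ^ j)))) =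
      finrank K (LinearMap.ker N ⊓ U.map (N ^ j) : Submodule K V) := by
    rw [LinearMap.ker_domRestrict, inf_comm]
    exact (Submodule.finrank_map_subtype_eq _ _).symm.trans
      (by rw [Submodule.map_comap_subtype])
  rw [h1, h2] at h
  omega

/-- The subspace `U` has no Jordan block of size exactly `k` for the nilpotent `N`. -/
def NoBlock (N : End K V) (U : Submodule K V) (k : ℕ) : Prop :=
  ∀ x ∈ U, (N ^ k) x = 0 → ∃ y ∈ U, (N ^ (k - 1)) x = (N ^ k) y

omit [FiniteDimensional K V] in
lemma noBlock_iff {N : End K V} {U : Submodule K V} (hU : ∀ x ∈ U, N x ∈ U) (k : ℕ) :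
    NoBlock N U (k + 1) ↔
      LinearMap.ker N ⊓ U.map (N ^ k) = LinearMap.ker N ⊓ U.map (N ^ (k + 1)) := by
  have hle : LinearMap.ker N ⊓ U.map (N ^ (k + 1)) ≤ LinearMap.ker N ⊓ U.map (N ^ k) := by
    refine inf_le_inf_left _ ?_
    rintro _ ⟨y, hy, rfl⟩
    exact ⟨N y, hU y hy, by rw [pow_succ]; rfl⟩
  constructor
  · intro h
    refine le_antisymm ?_ hle
    rintro _ ⟨hx, ⟨x, hxU, rfl⟩⟩
    refine ⟨hx, ?_⟩
    obtain ⟨y, hy, hxy⟩ := h x hxU (by rw [pow_succ']; exact hx)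
    exact ⟨y, hy, hxy.symm⟩
  · intro h x hx hxk
    have : (N ^ k) x ∈ LinearMap.ker N ⊓ U.map (N ^ k) :=
      ⟨by rw [pow_succ'] at hxk; exact hxk, ⟨x, hx, rfl⟩⟩
    rw [h] at this
    obtain ⟨y, hy, hxy⟩ := this.2
    exact ⟨y, hy, hxy.symm⟩

/-- If all block sizes are multiples of `d`, then so is the dimension. -/
lemma dvd_finrank_of_noBlock {N : End K V} (hN : IsNilpotent N) {U : Submodule K V}
    (hU : ∀ x ∈ U, N x ∈ U) {d : ℕ} (hd : 0 < d)
    (h : ∀ k, ¬ d ∣ k → NoBlock N U k) : d ∣ finrank K U := by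
  obtain ⟨M, hM⟩ := hN
  have step : ∀ t i, i ≤ d → i * finrank K (LinearMap.ker N ⊓ U.map (N ^ (t * d)) : Submodule K V)
      + finrank K (U.map (N ^ (t * d + i))) = finrank K (U.map (N ^ (t * d))) := by
    intro t i
    have hk : ∀ j, j < d → LinearMap.ker N ⊓ U.map (N ^ (t * d + j)) =
        LinearMap.ker N ⊓ U.map (N ^ (t * d)) := by
      intro j
      induction j with
      | zero => intro _; rfl
      | succ j ih =>
        intro hj
        rw [← ih (by omega), ← add_assoc]
        refine ((noBlock_iff hU _).1 (h _ ?_)).symm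
        rw [add_assoc, Nat.dvd_add_right (Dvd.intro_left t rfl)]
        exact Nat.not_dvd_of_pos_of_lt (Nat.succ_pos j) hj
    induction i with
    | zero => intro _; simp
    | succ i ih =>
      intro hi
      have h1 := ih (by omega)
      have h2 := finrank_map_pow_eq N U (t * d + i)
      rw [hk i (by omega)] at h2
      rw [← add_assoc, add_mul, one_mul]
      omega
  have hdvd : ∀ t, d ∣ finrank K U ↔ d ∣ finrank K (U.map (N ^ (t * d))) := by
    intro t
    induction t with
    | zero =>
      have : U.map (N ^ (0 * d)) = U := by
        rw [zero_mul, pow_zero, Module.End.one_eq_id, Submodule.map_id]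
      rw [this]
    | succ t ih =>
      rw [ih, ← step t d le_rfl, Nat.dvd_add_right (Dvd.intro _ rfl), add_mul, one_mul]
  rw [hdvd M]
  have : N ^ (M * d) = 0 := by
    rw [pow_mul, hM, zero_pow hd.ne']
  rw [this, Submodule.map_zero, finrank_bot]
  exact dvd_zero d

/-- A multiset with the right tail counts contains `k` iff there is a block of size `k`. -/
lemma mem_iff_not_noBlock {N : End K V} {U : Submodule K V} (hU : ∀ x ∈ U, N x ∈ U)
    {Λ : Multiset ℕ}
    (h : ∀ k, 1 ≤ k → (Λ.filter (fun i => k ≤ i)).card =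
      finrank K (U.map (N ^ (k - 1))) - finrank K (U.map (N ^ k)))
    {k : ℕ} (hk : 1 ≤ k) : k ∈ Λ ↔ ¬ NoBlock N U k := by
  obtain ⟨k, rfl⟩ : ∃ j, k = j + 1 := ⟨k - 1, by omega⟩
  have h1 := h (k + 1) hk
  have h2 := h (k + 2) (by omega)
  have e1 := finrank_map_pow_eq N U k
  have e2 := finrank_map_pow_eq N U (k + 1)
  have hcount : (Λ.filter (fun i => k + 1 ≤ i)).card =
      Λ.count (k + 1) + (Λ.filter (fun i => k + 2 ≤ i)).card := by
    clear h h1 h2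
    induction Λ using Multiset.induction_on with
    | empty => simp
    | cons a s ih =>
      rw [Multiset.filter_cons, Multiset.filter_cons, Multiset.count_cons, Multiset.card_add,
        Multiset.card_add, ih]
      rcases lt_trichotomy a (k + 1) with h | h | h
      · simp [show ¬ (k + 1 ≤ a) by omega, show ¬ (k + 2 ≤ a) by omega, show k + 1 ≠ a by omega]
      · simp [h]; omega
      · simp [show (k + 1 ≤ a) by omega, show (k + 2 ≤ a) by omega, show k + 1 ≠ a by omega]
        omega
  rw [Nat.add_sub_cancel] at h1
  rw [show k + 2 - 1 = k + 1 by omega] at h2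
  rw [← Multiset.count_pos, noBlock_iff hU]
  have hle : LinearMap.ker N ⊓ U.map (N ^ (k + 1)) ≤ LinearMap.ker N ⊓ U.map (N ^ k) := by
    refine inf_le_inf_left _ ?_
    rintro _ ⟨y, hy, rfl⟩
    exact ⟨N y, hU y hy, by rw [pow_succ]; rfl⟩
  constructor
  · intro hc heq
    rw [heq] at e1
    have e2' : finrank K (U.map (N ^ (k + 2))) = finrank K (U.map (N ^ (k + 1 + 1))) := rfl
    omega
  · intro hne
    have hlt := Submodule.finrank_lt_finrank_of_lt (lt_of_le_of_ne hle (Ne.symm hne))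
    have e2' : finrank K (U.map (N ^ (k + 2))) = finrank K (U.map (N ^ (k + 1 + 1))) := rfl
    omega

end Jordan

section Projectors

open Polynomial

lemma commute_aeval_of_commute {F A : Type*} [Field F] [Ring A] [Algebra F A] {S N : A}
    (h : Commute S N) (b : F[X]) : Commute (aeval S b) N := by
  refine Polynomial.induction_on b (fun a => ?_) (fun p q hp hq => ?_) (fun n a _ => ?_)
  · rw [aeval_C]
    exact Algebra.commutes a N
  · rw [map_add]
    exact hp.add_left hq
  · rw [map_mul, aeval_C, map_pow, aeval_X]
    exact (show Commute (algebraMap F A a) N from Algebra.commutes a N).mul_left (h.pow_left _)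

/-- A polynomial projecting onto the primary part attached to a factor of `X ^ m - 1`. -/
lemma exists_projector_poly {F : Type*} [Field F] {m : ℕ} (hm : (m : F) ≠ 0) {f : F[X]}
    (hf : f ∣ X ^ m - 1) : ∃ b : F[X], (X ^ m - 1 ∣ f * b) ∧ f ∣ b - 1 := by
  obtain ⟨g, hg⟩ := hf
  have hsep : (X ^ m - C (1 : F)).Separable := separable_X_pow_sub_C (1 : F) hm one_ne_zero
  rw [C_1, hg] at hsep
  obtain ⟨a, b, hab⟩ := hsep.isCoprime
  exact ⟨b * g, ⟨b, by rw [hg]; ring⟩, ⟨-a, by linear_combination hab⟩⟩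

variable {K V : Type*} [Field K] [AddCommGroup V] [Module K V]

/-- The existence of `π` splitting off an eigenspace transports an identity between
endomorphisms to the absence of blocks on the eigenspace. -/
lemma noBlock_eigenspace_of_identity {S N P X Y : End K V} {m : ℕ} (hm : (m : K) ≠ 0)
    (hS : S ^ m = 1) (hSN : Commute S N) {ξ : K} (hξ : ξ ^ m = 1)
    {k : ℕ} (hid : N ^ (k - 1) * P = N ^ k * Y + X * (N ^ k * P))
    (hP : ∀ v ∈ S.eigenspace ξ, P v = v) : NoBlock N (S.eigenspace ξ) k := by
  obtain ⟨b, hb1, hb2⟩ := exists_projector_poly hm (f := Polynomial.X - C ξ)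
    (dvd_iff_isRoot.2 (by simp [IsRoot, hξ]))
  have hzero : (S - algebraMap K _ ξ) * aeval S b = 0 := by
    obtain ⟨c, hc⟩ := hb1
    have := congrArg (aeval S) hc
    simpa [hS] using this
  have hone : ∀ v ∈ S.eigenspace ξ, aeval S b v = v := by
    intro v hv
    obtain ⟨c, hc⟩ := hb2
    have := congrArg (fun r => aeval S r v) hc
    rw [mul_comm] at this
    simp only [map_sub, map_one, map_mul, aeval_X, aeval_C, LinearMap.sub_apply,
      Module.End.one_apply, Module.End.mul_apply] at this
    rw [Module.End.mem_eigenspace_iff] at hv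
    rw [← sub_eq_zero, this, Module.algebraMap_end_apply, hv, sub_self]
  have hcomm : Commute (aeval S b) N := commute_aeval_of_commute hSN b
  intro v hv hNv
  refine ⟨aeval S b (Y v), ?_, ?_⟩
  · rw [Module.End.mem_eigenspace_iff, ← sub_eq_zero]
    exact LinearMap.congr_fun hzero (Y v)
  · have h1 := LinearMap.congr_fun hid v
    simp only [Module.End.mul_apply, LinearMap.add_apply, hP v hv, hNv, map_zero, add_zero] at h1
    have hmem : (N ^ (k - 1)) v ∈ S.eigenspace ξ := by
      rw [Module.End.mem_eigenspace_iff] at hv ⊢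
      have := LinearMap.congr_fun (hSN.pow_right (k - 1)).eq v
      simp only [Module.End.mul_apply] at this
      rw [this, hv, map_smul]
    have h2 := LinearMap.congr_fun (hcomm.pow_right k).eq (Y v)
    simp only [Module.End.mul_apply] at h2
    rw [← h2, ← h1, hone _ hmem]

/-- Absence of blocks on all eigenspaces of a diagonalizable map implies absence of blocks. -/
lemma noBlock_top_of_eigenspaces [IsAlgClosed K] {S N : End K V} {m : ℕ} (hm : (m : K) ≠ 0)
    (hS : S ^ m = 1) (hSN : Commute S N) {k : ℕ}
    (h : ∀ ξ : K, S.HasEigenvalue ξ → NoBlock N (S.eigenspace ξ) k) : NoBlock N ⊤ k := by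
  classical
  have : NeZero (m : K) := ⟨hm⟩
  have hm0 : 0 < m := Nat.pos_of_ne_zero (by rintro rfl; simp at hm)
  obtain ⟨ω, hω⟩ := HasEnoughRootsOfUnity.exists_primitiveRoot K m
  set T := nthRootsFinset m (1 : K) with hT
  have hTne : T.Nonempty := ⟨1, by rw [hT, mem_nthRootsFinset hm0]; simp⟩
  have hinj : Set.InjOn (id : K → K) (T : Set K) := Function.injective_id.injOn
  have hnodal : Lagrange.nodal T (id : K → K) = X ^ m - 1 := by
    rw [X_pow_sub_one_eq_prod hm0 hω, Lagrange.nodal_eq]; rfl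
  set e : K → End K V := fun ξ => aeval S (Lagrange.basis T id ξ) with he
  have hsum : ∑ ξ ∈ T, e ξ = 1 := by
    rw [he, ← map_sum, Lagrange.sum_basis hinj hTne, map_one]
  have hker : ∀ ξ ∈ T, ∀ v, e ξ v ∈ S.eigenspace ξ := by
    intro ξ hξ v
    have h0 : (X - C ξ) * Lagrange.basis T id ξ = C (Lagrange.nodalWeight T id ξ) * (X ^ m - 1) := by
      rw [Lagrange.basis_eq_prod_sub_inv_mul_nodal_div hξ, ← Lagrange.nodal_erase_eq_nodal_div hξ,
        ← hnodal, Lagrange.nodal_eq_mul_nodal_erase hξ]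
      simp only [id]
      ring
    have h1 := congrArg (fun r => aeval S r v) h0
    simp only [map_sub, map_one, map_mul, aeval_X, aeval_C, map_pow, hS, sub_self, mul_zero,
      LinearMap.zero_apply] at h1
    rw [Module.End.mem_eigenspace_iff, ← sub_eq_zero]
    exact h1
  have hcomm : ∀ ξ, Commute N (e ξ) := fun ξ =>
    (commute_aeval_of_commute hSN _).symm
  have hdec : ∀ v, v = ∑ ξ ∈ T, e ξ v := by
    intro v
    rw [← LinearMap.sum_apply, hsum, Module.End.one_apply]
  intro x _ hx
  have key : ∀ ξ ∈ T, ∃ y, (N ^ (k - 1)) (e ξ x) = (N ^ k) y := by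
    intro ξ hξ
    by_cases hev : S.HasEigenvalue ξ
    · obtain ⟨y, -, hy⟩ := h ξ hev (e ξ x) (hker ξ hξ x) (by
        have := LinearMap.congr_fun ((hcomm ξ).pow_left k).eq x
        simp only [Module.End.mul_apply] at this
        rw [this, hx, map_zero])
      exact ⟨y, hy⟩
    · have : e ξ x = 0 := by
        have h0 := hker ξ hξ x
        rw [Module.End.hasEigenvalue_iff, not_not] at hev
        rw [hev] at h0
        simpa using h0
      exact ⟨0, by rw [this, map_zero, map_zero]⟩
  choose! y hy using key
  refine ⟨∑ ξ ∈ T, y ξ, trivial, ?_⟩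
  rw [map_sum, ← Finset.sum_congr rfl hy, ← map_sum, ← hdec x]

/-- Absence of blocks passes to the generalized eigenspaces of a commuting map. -/
lemma noBlock_maxGenEigenspace [FiniteDimensional K V] {G N : End K V} (hGN : Commute G N) {k : ℕ}
    (h : NoBlock N ⊤ k) (ζ : K) : NoBlock N (G.maxGenEigenspace ζ) k := by
  set f := G - ζ • (1 : End K V) with hf
  have hcomm : Commute f N := hGN.sub_left ((Commute.one_left N).smul_left ζ)
  have hcompl : IsCompl (G.maxGenEigenspace ζ) (⨅ n, LinearMap.range (f ^ n)) := by
    have := LinearMap.isCompl_iSup_ker_pow_iInf_range_pow f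
    convert this using 1
    ext x
    rw [Module.End.mem_maxGenEigenspace, Submodule.mem_iSup_of_directed]
    · rfl
    · refine Monotone.directed_le fun i j hij => ?_
      obtain ⟨l, rfl⟩ := Nat.exists_eq_add_of_le hij
      rw [add_comm, pow_add]
      exact LinearMap.ker_le_ker_comp _ _
  have hN1 : ∀ x ∈ G.maxGenEigenspace ζ, (N ^ k) x ∈ G.maxGenEigenspace ζ := fun x hx =>
    Module.End.mapsTo_maxGenEigenspace_of_comm (hGN.pow_right k) ζ hx
  have hN1' : ∀ x ∈ G.maxGenEigenspace ζ, (N ^ (k - 1)) x ∈ G.maxGenEigenspace ζ := fun x hx =>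
    Module.End.mapsTo_maxGenEigenspace_of_comm (hGN.pow_right (k - 1)) ζ hx
  have hN2 : ∀ x ∈ (⨅ n, LinearMap.range (f ^ n)), (N ^ k) x ∈ (⨅ n, LinearMap.range (f ^ n)) := by
    intro x hx
    rw [Submodule.mem_iInf] at hx ⊢
    intro n
    obtain ⟨y, rfl⟩ := hx n
    exact ⟨(N ^ k) y, LinearMap.congr_fun (hcomm.pow_pow n k).eq y⟩
  intro x hx hxk
  obtain ⟨y, -, hy⟩ := h x trivial hxk
  obtain ⟨a, ha, b, hb, rfl⟩ := Submodule.mem_sup.1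
    (hcompl.sup_eq_top ▸ (Submodule.mem_top : y ∈ (⊤ : Submodule K V)))
  refine ⟨a, ha, ?_⟩
  rw [map_add] at hy
  have hmem : (N ^ k) b ∈ G.maxGenEigenspace ζ := by
    have : (N ^ k) b = (N ^ (k - 1)) x - (N ^ k) a := by rw [hy]; abel
    rw [this]
    exact sub_mem (hN1' x hx) (hN1 a ha)
  have : (N ^ k) b ∈ (⊥ : Submodule K V) := by
    rw [← hcompl.inf_eq_bot]
    exact ⟨hmem, hN2 b hb⟩
  rw [hy, (Submodule.mem_bot K).1 this, add_zero]

end Projectors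

section SelfDual

open Polynomial

variable {K : Type*} [Field K]

/-- A `d`-th root of a self-dual polynomial has constant coefficient of norm one. -/
lemma coeff_zero_pow_eq_one_of_selfDual {φ : K →+* K} {q : ℕ} (hφ : ∀ x, φ x = x ^ q)
    {Q : K[X]} (hQ : Q.Monic) {d : ℕ} (hd : 0 < d) {c : K}
    (h : (Q ^ d).map φ = C c * (Q ^ d).reverse) : Q.coeff 0 ^ (q + 1) = 1 := by
  have hrev : (Q ^ d).reverse = Q.reverse ^ d := by
    clear h hd
    induction d with
    | zero => simpa using reverse_C (1 : K)
    | succ d ih => rw [pow_succ, reverse_mul_of_domain, ih, pow_succ]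
  rw [hrev, Polynomial.map_pow] at h
  have hA : (Q.map φ).Monic := hQ.map φ
  have hc : c ≠ 0 := by
    rintro rfl
    rw [C_0, zero_mul] at h
    exact (pow_ne_zero d hA.ne_zero) h
  have hdvd : Q.map φ ∣ Q.reverse := by
    rw [← IsIntegrallyClosed.pow_dvd_pow_iff hd.ne', h]
    exact ⟨C c⁻¹, by rw [mul_right_comm, ← C_mul, mul_inv_cancel₀ hc, C_1, one_mul]⟩
  obtain ⟨R, hR⟩ := hdvd
  have hR0 : R ≠ 0 := by
    rintro rfl
    rw [mul_zero, reverse_eq_zero] at hR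
    exact hQ.ne_zero hR
  have hdeg := reverse_natDegree_le Q
  rw [hR, hA.natDegree_mul' hR0, hQ.natDegree_map] at hdeg
  obtain ⟨r, rfl⟩ := natDegree_eq_zero.1 (show R.natDegree = 0 by omega)
  have h0 := congrArg (fun P => P.coeff 0) hR
  have h1 := congrArg (fun P => P.coeff Q.natDegree) hR
  simp only [coeff_mul_C, coeff_map, coeff_zero_reverse, hQ.leadingCoeff, hφ] at h0
  rw [coeff_reverse, revAt_le le_rfl, Nat.sub_self, coeff_mul_C, coeff_map, hQ.coeff_natDegree,
    map_one, one_mul] at h1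
  rw [pow_succ, h0, h1]

/-- The characteristic polynomial is a `d`-th power if all root multiplicities are divisible
by `d`. -/
lemma exists_monic_pow_eq_of_dvd_rootMultiplicity [IsAlgClosed K] {P : K[X]} (hP : P.Monic) {d : ℕ}
    (h : ∀ a, d ∣ P.rootMultiplicity a) : ∃ Q : K[X], Q.Monic ∧ P = Q ^ d := by
  classical
  refine ⟨∏ a ∈ P.roots.toFinset, (X - C a) ^ (P.rootMultiplicity a / d),
    monic_prod_of_monic _ _ fun a _ => (monic_X_sub_C a).pow _, ?_⟩
  conv_lhs => rw [(IsAlgClosed.splits P).eq_prod_roots_of_monic hP,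
    prod_multiset_root_eq_finset_root]
  rw [← Finset.prod_pow]
  refine Finset.prod_congr rfl fun a _ => ?_
  rw [← pow_mul, Nat.div_mul_cancel (h a)]

end SelfDual

section Counting

lemma card_eq_ncard_conj_mul {G : Type*} [Group G] [Finite G] (S : Subgroup G) (h : G) :
    Nat.card S = {x : G | ∃ g : G, g ∈ S ∧ x = g * h * g⁻¹}.ncard *
      Nat.card (S ⊓ Subgroup.centralizer {h} : Subgroup G) := by
  let _ : MulAction S G := MulAction.compHom G (MulAut.conj.comp S.subtype : S →* MulAut G)
  have hsmul : ∀ (g : S) (x : G), g • x = g * x * (g : G)⁻¹ := fun g x => rfl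
  have h1 : {x : G | ∃ g : G, g ∈ S ∧ x = g * h * g⁻¹} = MulAction.orbit S h := by
    ext x
    constructor
    · rintro ⟨g, hg, rfl⟩
      exact ⟨⟨g, hg⟩, rfl⟩
    · rintro ⟨g, rfl⟩
      exact ⟨g, g.2, rfl⟩
  have h2 : (MulAction.stabilizer S h).map S.subtype = S ⊓ Subgroup.centralizer {h} := by
    ext x
    simp only [Subgroup.mem_map, MulAction.mem_stabilizer_iff, hsmul, Subgroup.mem_inf,
      Subgroup.mem_centralizer_singleton_iff, Subgroup.coe_subtype]
    constructor
    · rintro ⟨g, hg, rfl⟩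
      exact ⟨g.2, mul_inv_eq_iff_eq_mul.1 hg⟩
    · rintro ⟨hx, hxh⟩
      exact ⟨⟨x, hx⟩, mul_inv_eq_iff_eq_mul.2 hxh, rfl⟩
  rw [h1, ← MulAction.index_stabilizer, ← h2, mul_comm,
    Nat.card_congr ((MulAction.stabilizer S h).equivMapOfInjective _
      S.subtype_injective).symm.toEquiv]
  exact (Subgroup.card_mul_index _).symm

lemma card_eq_card_inf_ker_mul {G A : Type*} [Group G] [Group A] (φ : G →* A) (S : Subgroup G) :
    Nat.card S = Nat.card (S ⊓ φ.ker : Subgroup G) * Nat.card (S.map φ) := by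
  rw [← Subgroup.relIndex_ker, ← Subgroup.inf_relIndex_left, Subgroup.relIndex]
  rw [← Subgroup.card_mul_index ((S ⊓ φ.ker).subgroupOf S)]
  congr 1
  exact (Nat.card_congr (Subgroup.subgroupOfEquivOfLe inf_le_left).toEquiv)

/-- A class of the kernel of `φ` compared to a class of the ambient group. -/
lemma ncard_conj_eq_mul {G A : Type*} [Group G] [Finite G] [Group A] [Finite A] (φ : G →* A)
    (S : Subgroup G) (h : G) {d L : ℕ} (hL : Nat.card (S.map φ) = L)
    (hd : Nat.card ((S ⊓ Subgroup.centralizer {h}).map φ) * d = L) :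
    {x : G | ∃ g : G, g ∈ S ∧ x = g * h * g⁻¹}.ncard =
      d * {x : G | ∃ g : G, g ∈ S ⊓ φ.ker ∧ x = g * h * g⁻¹}.ncard := by
  have e1 := card_eq_ncard_conj_mul S h
  have e2 := card_eq_ncard_conj_mul (S ⊓ φ.ker) h
  have e3 := card_eq_card_inf_ker_mul φ S
  have e4 := card_eq_card_inf_ker_mul φ (S ⊓ Subgroup.centralizer {h})
  rw [inf_right_comm] at e2
  rw [hL] at e3
  have p1 : 0 < Nat.card (S ⊓ Subgroup.centralizer {h} ⊓ φ.ker : Subgroup G) := Nat.card_pos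
  have p2 : 0 < Nat.card ((S ⊓ Subgroup.centralizer {h}).map φ) := Nat.card_pos
  refine Nat.eq_of_mul_eq_mul_right (Nat.mul_pos p1 p2) ?_
  calc _ = Nat.card S := by rw [← e4, ← e1]
    _ = _ := by rw [e3, e2, ← hd]; ac_rfl

lemma card_mul_eq_of_cyclic {A : Type*} [CommGroup A] [Finite A] [IsCyclic A] {D : Subgroup A}
    {ω : A} {L d : ℕ} (hω : orderOf ω = L) (hdL : d ∣ L)
    (hD : ∀ x ∈ D, x ^ (L / d) = 1) (I : Set ℕ)
    (hI : ∀ t, t ∣ L → (∀ i ∈ I, t ∣ i) → t ∣ d) (hmem : ∀ i ∈ I, ω ^ i ∈ D) :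
    Nat.card D * d = L := by
  classical
  have hLpos : 0 < L := hω ▸ orderOf_pos ω
  have hdpos : 0 < d := Nat.pos_of_dvd_of_pos hdL hLpos
  have hiff : ∀ i, orderOf (QuotientGroup.mk ω : A ⧸ D) ∣ i ↔ ω ^ i ∈ D := by
    intro i
    rw [orderOf_dvd_iff_pow_eq_one, ← QuotientGroup.mk_pow, QuotientGroup.eq_one_iff]
  have hωd : ω ^ d ∈ D := by
    rw [← hiff]
    refine hI _ ((hiff L).2 ?_) fun i hi => (hiff i).2 (hmem i hi)
    rw [← hω, pow_orderOf_eq_one]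
    exact one_mem D
  have hord : orderOf (ω ^ d) = L / d := by
    rw [← hω] at hdL ⊢
    exact orderOf_pow_of_dvd hdpos.ne' hdL
  have hge : L / d ≤ Nat.card D := by
    rw [← hord]
    exact Nat.le_of_dvd Nat.card_pos (Subgroup.orderOf_dvd_natCard D hωd)
  have hle : Nat.card D ≤ L / d := by
    have : Fintype A := Fintype.ofFinite A
    refine le_trans ?_ (IsCyclic.card_pow_eq_one_le (α := A) (Nat.div_pos
      (Nat.le_of_dvd hLpos hdL) hdpos))
    rw [← Set.ncard_coe_finset]
    simp only [Finset.coe_filter, Finset.mem_univ, true_and]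
    change (D : Set A).ncard ≤ _
    exact Set.ncard_le_ncard (fun x hx => hD x hx) (Set.toFinite _)
  rw [le_antisymm hle hge, Nat.div_mul_cancel hdL]

end Counting

section Splitting

lemma LinearMap.det_one_add_comp_comm {F U V : Type*} [Field F] [AddCommGroup U] [Module F U]
    [AddCommGroup V] [Module F V] [FiniteDimensional F U] [FiniteDimensional F V]
    (A : U →ₗ[F] V) (B : V →ₗ[F] U) :
    LinearMap.det (1 + A ∘ₗ B) = LinearMap.det (1 + B ∘ₗ A) := by
  classical
  let bU := Module.finBasis F U
  let bV := Module.finBasis F V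
  rw [← LinearMap.det_toMatrix bV, ← LinearMap.det_toMatrix bU, map_add, map_add,
    LinearMap.toMatrix_comp bV bU bV, LinearMap.toMatrix_comp bU bV bU,
    LinearMap.toMatrix_one, LinearMap.toMatrix_one, Matrix.det_one_add_mul_comm]

variable {F L V : Type*} [Field F] [Field L] [Algebra F L] [FiniteDimensional F L]
  [AddCommGroup V] [Module F V] [FiniteDimensional F V]

/-- A nilpotent Jordan block over the extension field `L`, acting through `ψ`, splits off. -/
lemma exists_idempotent_of_block (ψ : L →ₗ[F] End F V) (hψ : ∀ a b, ψ (a * b) = ψ a * ψ b)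
    {N : End F V} (hN : ∀ a, Commute N (ψ a)) {i : ℕ} (hi : 0 < i) {v : V} (hv : ψ 1 v = v)
    (hNv : (N ^ i) v = 0) {w : V →ₗ[F] F} (hw : ∀ x, w (ψ 1 x) = w x)
    (hNw : ∀ x, w ((N ^ i) x) = 0) (hvw : w ((N ^ (i - 1)) v) ≠ 0) :
    ∃ e : End F V, e * e = e ∧ e v = v ∧ (∀ x, w (e x) = w x) ∧ ψ 1 * e = e ∧ e * ψ 1 = e ∧
      Commute N e ∧ (∀ a, Commute (ψ a) e) ∧
      (∀ x, ∃ c : Fin i → L, e x = ∑ j : Fin i, (N ^ (j : ℕ)) (ψ (c j) v)) ∧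
      ∀ a, LinearMap.det (1 + (ψ a - 1) * e) = Algebra.norm F a ^ i := by
  let Φ : (Fin i → L) →ₗ[F] V :=
    ∑ j : Fin i, (N ^ (j : ℕ)) ∘ₗ (LinearMap.applyₗ v) ∘ₗ ψ ∘ₗ LinearMap.proj j
  have hΦ : ∀ c, Φ c = ∑ j : Fin i, (N ^ (j : ℕ)) (ψ (c j) v) := fun c => by
    simp [Φ, LinearMap.sum_apply]
  let Ψ : V →ₗ[F] (Fin i → Dual F L) := LinearMap.pi fun j =>
    (LinearMap.lcomp F F ψ) ∘ₗ
      ((LinearMap.llcomp F (End F V) V F (w ∘ₗ N ^ (j : ℕ))) ∘ₗ LinearMap.applyₗ)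
  have hΨ : ∀ x j a, Ψ x j a = w ((N ^ (j : ℕ)) (ψ a x)) := fun x j a => rfl
  have hψ1 : ∀ a x, ψ 1 (ψ a x) = ψ a x := fun a x => by
    rw [← Module.End.mul_apply, ← hψ, one_mul]
  have hψ2 : ∀ a x, ψ a (ψ 1 x) = ψ a x := fun a x => by
    rw [← Module.End.mul_apply, ← hψ, mul_one]
  have hNψ : ∀ a m x, ψ a ((N ^ m) x) = (N ^ m) (ψ a x) := fun a m x => by
    rw [← Module.End.mul_apply, ← Module.End.mul_apply, ((hN a).pow_left m).eq]
  have hNz : ∀ m, i ≤ m → ∀ a, (N ^ m) (ψ a v) = 0 := fun m hm a => by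
    obtain ⟨r, rfl⟩ := Nat.exists_eq_add_of_le' hm
    rw [← hNψ, pow_add, Module.End.mul_apply, hNv, map_zero, map_zero]
  have hwz : ∀ m, i ≤ m → ∀ x, w ((N ^ m) x) = 0 := fun m hm x => by
    obtain ⟨r, rfl⟩ := Nat.exists_eq_add_of_le hm
    rw [pow_add, Module.End.mul_apply, hNw]
  have hΦmem : ∀ m a, (N ^ m) (ψ a v) ∈ LinearMap.range Φ := fun m a => by
    by_cases hm : m < i
    · refine ⟨Pi.single ⟨m, hm⟩ a, ?_⟩
      rw [hΦ, Finset.sum_eq_single (⟨m, hm⟩ : Fin i)]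
      · simp
      · intro j _ hj
        simp [Pi.single_eq_of_ne hj]
      · simp
    · rw [hNz m (not_lt.1 hm)]
      exact zero_mem _
  have hΨmem : ∀ x, Ψ x = 0 → ∀ m a, w ((N ^ m) (ψ a x)) = 0 := fun x hx m a => by
    by_cases hm : m < i
    · rw [← hΨ x ⟨m, hm⟩, hx]
      rfl
    · exact hwz m (not_lt.1 hm) _
  have hinj : Function.Injective (Ψ ∘ₗ Φ) := by
    rw [← LinearMap.ker_eq_bot, LinearMap.ker_eq_bot']
    intro c hc
    by_contra hne
    have hex : ∃ j : ℕ, ∃ hj : j < i, c ⟨j, hj⟩ ≠ 0 := by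
      by_contra! hall
      exact hne (funext fun j => hall j j.2)
    classical
    obtain ⟨hj, hcj⟩ := Nat.find_spec hex
    have hmin : ∀ r : Fin i, (r : ℕ) < Nat.find hex → c r = 0 := fun r hr => by
      by_contra h
      exact Nat.find_min hex hr ⟨r.2, h⟩
    set j₀ := Nat.find hex
    have key : (N ^ (i - 1 - j₀)) (ψ (c ⟨j₀, hj⟩)⁻¹ (Φ c)) = (N ^ (i - 1)) v := by
      rw [hΦ, map_sum, map_sum, Finset.sum_eq_single (⟨j₀, hj⟩ : Fin i)]
      · rw [hNψ, ← Module.End.mul_apply (ψ _), ← hψ, inv_mul_cancel₀ hcj, hv,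
          ← Module.End.mul_apply, ← pow_add]
        congr 2
        simp only
        omega
      · intro r _ hr
        rw [hNψ, ← Module.End.mul_apply (ψ _), ← hψ, ← Module.End.mul_apply, ← pow_add]
        rcases lt_or_ge (r : ℕ) j₀ with h | h
        · rw [hmin r h]
          simp
        · refine hNz _ ?_ _
          have : (r : ℕ) ≠ j₀ := fun h => hr (Fin.ext h)
          omega
      · simp
    refine hvw ?_
    rw [← key]
    exact hΨmem (Φ c) hc _ _
  have hfr : finrank F (Fin i → L) = finrank F (Fin i → Dual F L) := by
    rw [Module.finrank_pi_fintype, Module.finrank_pi_fintype]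
    simp [Subspace.dual_finrank_eq]
  let M := LinearMap.linearEquivOfInjective (Ψ ∘ₗ Φ) hinj hfr
  have hM : ∀ c, M c = Ψ (Φ c) := fun c => rfl
  let e : End F V := Φ ∘ₗ M.symm.toLinearMap ∘ₗ Ψ
  have heΦ : ∀ c, e (Φ c) = Φ c := fun c => by
    change Φ (M.symm (Ψ (Φ c))) = Φ c
    rw [← hM, LinearEquiv.symm_apply_apply]
  have hΨe : ∀ x, Ψ (e x) = Ψ x := fun x => by
    change Ψ (Φ (M.symm (Ψ x))) = Ψ x
    rw [← hM, LinearEquiv.apply_symm_apply]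
  have hex : ∀ x, e x = Φ (M.symm (Ψ x)) := fun x => rfl
  have hee : e * e = e := LinearMap.ext fun x => by
    rw [Module.End.mul_apply, hex x, heΦ]
  have hfix : ∀ y ∈ LinearMap.range Φ, e y = y := by
    rintro _ ⟨c, rfl⟩
    exact heΦ c
  have hcomm : ∀ T : End F V, (∀ m a, T ((N ^ m) (ψ a v)) ∈ LinearMap.range Φ) →
      (∀ x, Ψ x = 0 → Ψ (T x) = 0) → Commute T e := by
    intro T h1 h2
    refine LinearMap.ext fun x => ?_
    rw [Module.End.mul_apply, Module.End.mul_apply]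
    have hx : e (T (x - e x)) = 0 := by
      rw [hex, h2 (x - e x) (by rw [map_sub, hΨe, sub_self]), map_zero, map_zero]
    have hTe : e (T (e x)) = T (e x) := by
      refine hfix _ ?_
      rw [hex, hΦ, map_sum]
      exact sum_mem fun j _ => h1 _ _
    rw [map_sub, map_sub, hTe, sub_eq_zero] at hx
    exact hx.symm
  have hΨext : ∀ x, (∀ m a, w ((N ^ m) (ψ a x)) = 0) → Ψ x = 0 := fun x h =>
    funext fun j => LinearMap.ext fun a => h j a
  refine ⟨e, hee, ?_, ?_, ?_, ?_, ?_, ?_, ?_, ?_⟩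
  · refine hfix v ?_
    have := hΦmem 0 1
    rwa [pow_zero, Module.End.one_apply, hv] at this
  · intro x
    have h := congrFun (hΨe x) ⟨0, hi⟩
    have h' := LinearMap.congr_fun h 1
    rw [hΨ, hΨ] at h'
    simpa [hw] using h'
  · refine LinearMap.ext fun x => ?_
    rw [Module.End.mul_apply, hex, hΦ, map_sum]
    simp_rw [hNψ, hψ1]
  · refine LinearMap.ext fun x => ?_
    rw [Module.End.mul_apply, hex, hex]
    congr 2
    refine funext fun j => LinearMap.ext fun a => ?_
    rw [hΨ, hΨ, hψ2]
  · refine hcomm N (fun m a => ?_) fun x hx => hΨext _ fun m a => ?_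
    · rw [← Module.End.mul_apply, ← pow_succ']
      exact hΦmem _ _
    · have := hNψ a 1 x
      rw [pow_one] at this
      rw [this, ← Module.End.mul_apply, ← pow_succ]
      exact hΨmem x hx _ _
  · refine fun b => hcomm (ψ b) (fun m a => ?_) fun x hx => hΨext _ fun m a => ?_
    · rw [hNψ, ← Module.End.mul_apply (ψ _), ← hψ]
      exact hΦmem _ _
    · rw [← Module.End.mul_apply (ψ _), ← hψ]
      exact hΨmem x hx _ _
  · exact fun x => ⟨M.symm (Ψ x), by rw [hex, hΦ]⟩
  · intro a
    let A : (Fin i → L) →ₗ[F] (Fin i → L) :=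
      LinearMap.pi fun j => (Algebra.lmul F L a).comp (LinearMap.proj j)
    have hA : (ψ a - 1) * e = (Φ ∘ₗ (A - 1)) ∘ₗ (M.symm.toLinearMap ∘ₗ Ψ) := by
      refine LinearMap.ext fun x => ?_
      change (ψ a - 1) (e x) = Φ ((A - 1) (M.symm (Ψ x)))
      rw [hex]
      generalize M.symm (Ψ x) = c
      rw [LinearMap.sub_apply, LinearMap.sub_apply, map_sub, hΦ, map_sum, hΦ]
      rw [Module.End.one_apply, Module.End.one_apply, hΦ c]
      congr 1
      refine Finset.sum_congr rfl fun j _ => ?_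
      rw [hNψ, ← Module.End.mul_apply (ψ _), ← hψ]
      rfl
    rw [hA, LinearMap.det_one_add_comp_comm]
    have hB : (1 : End F (Fin i → L)) + (M.symm.toLinearMap ∘ₗ Ψ) ∘ₗ (Φ ∘ₗ (A - 1)) = A := by
      refine LinearMap.ext fun c => ?_
      change c + M.symm (Ψ (Φ ((A - 1) c))) = A c
      rw [← hM, LinearEquiv.symm_apply_apply, LinearMap.sub_apply]
      simp
    rw [hB, LinearMap.det_pi]
    simp [Algebra.norm_apply]

end Splitting

section Hermitian

/-- A nondegenerate hermitian form with respect to `τ`, together with its adjoint operation. -/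
structure HermitianAdjoint {F : Type*} [Field F] (τ : F →+* F) (V : Type*) [AddCommGroup V]
    [Module F V] where
  /-- the form -/
  form : V →ₗ[F] V →ₛₗ[τ] F
  /-- the adjoint of an endomorphism -/
  adj : End F V → End F V
  involutive : ∀ a, τ (τ a) = a
  form_symm : ∀ x y, form y x = τ (form x y)
  nondegenerate : ∀ y, (∀ x, form x y = 0) → y = 0
  riesz : ∀ w : V →ₗ[F] F, ∃ y, ∀ x, form x y = w x
  form_adj : ∀ A x y, form (A x) y = form x (adj A y)

namespace HermitianAdjoint

variable {F V : Type*} [Field F] {τ : F →+* F} [AddCommGroup V] [Module F V]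
  (H : HermitianAdjoint τ V)

lemma adj_eq_of {A T : End F V} (h : ∀ x y, H.form (A x) y = H.form x (T y)) : H.adj A = T := by
  refine LinearMap.ext fun y => sub_eq_zero.1 (H.nondegenerate _ fun x => ?_)
  rw [map_sub, ← H.form_adj, h, sub_self]

lemma adj_mul (A C : End F V) : H.adj (A * C) = H.adj C * H.adj A :=
  H.adj_eq_of fun x y => by
    rw [Module.End.mul_apply, Module.End.mul_apply, H.form_adj, H.form_adj]

lemma adj_add (A C : End F V) : H.adj (A + C) = H.adj A + H.adj C :=
  H.adj_eq_of fun x y => by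
    rw [LinearMap.add_apply, LinearMap.add_apply, map_add, map_add, LinearMap.add_apply,
      H.form_adj, H.form_adj]

lemma adj_sub (A C : End F V) : H.adj (A - C) = H.adj A - H.adj C :=
  H.adj_eq_of fun x y => by
    rw [LinearMap.sub_apply, LinearMap.sub_apply, map_sub, map_sub, LinearMap.sub_apply,
      H.form_adj, H.form_adj]

lemma adj_one : H.adj 1 = 1 := H.adj_eq_of fun _ _ => rfl

lemma adj_pow (A : End F V) (k : ℕ) : H.adj (A ^ k) = H.adj A ^ k := by
  induction k with
  | zero => rw [pow_zero, pow_zero, H.adj_one]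
  | succ k ih => rw [pow_succ, H.adj_mul, ih, ← pow_succ']

lemma adj_adj (A : End F V) : H.adj (H.adj A) = A :=
  H.adj_eq_of fun x y => by
    have hτ : ∀ a b, τ (H.form a b) = H.form b a := fun a b => (H.form_symm a b).symm
    rw [← hτ, ← H.form_adj, hτ]

lemma commute_adj {A C : End F V} (h : Commute A C) : Commute (H.adj A) (H.adj C) := by
  rw [commute_iff_eq, ← H.adj_mul, ← H.adj_mul, h.eq]

lemma commute_adj_of_isometry {Z s : End F V} (hs : H.adj s * s = 1) (hs' : s * H.adj s = 1)
    (h : Commute Z s) : Commute (H.adj Z) s := by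
  have h1 := H.commute_adj h
  have h2 : s * (H.adj Z * H.adj s) * s = s * (H.adj s * H.adj Z) * s := by rw [h1.eq]
  rw [← mul_assoc s, ← mul_assoc s, hs', one_mul, mul_assoc, mul_assoc, hs, mul_one] at h2
  exact h2.symm

lemma adj_smul (a : F) (A : End F V) : H.adj (a • A) = τ a • H.adj A :=
  H.adj_eq_of fun x y => by
    rw [LinearMap.smul_apply, LinearMap.smul_apply, map_smul, LinearMap.smul_apply, H.form_adj,
      LinearMap.map_smulₛₗ, H.involutive]

lemma adj_aeval (s : End F V) (b : Polynomial F) :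
    H.adj (Polynomial.aeval s b) = Polynomial.aeval (H.adj s) (b.map τ) := by
  induction b using Polynomial.induction_on' with
  | add f g hf hg => rw [map_add, H.adj_add, hf, hg, Polynomial.map_add, map_add]
  | monomial n a =>
    rw [Polynomial.map_monomial, Polynomial.aeval_monomial, Polynomial.aeval_monomial,
      ← Algebra.smul_def, ← Algebra.smul_def, H.adj_smul, H.adj_pow]

/-- Polarization. -/
lemma exists_form_self_ne_zero (hτ : ∃ a, τ a ≠ a) (W : Submodule F V) {A : End F V} {x y : V}
    (hx : x ∈ W) (hy : y ∈ W) (hxy : H.form (A x) y ≠ 0) : ∃ v ∈ W, H.form (A v) v ≠ 0 := by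
  by_contra! h
  obtain ⟨a, ha⟩ := hτ
  have key : ∀ c : F, τ c * H.form (A x) y + c * H.form (A y) x = 0 := fun c => by
    have h1 := h _ (W.add_mem hx (W.smul_mem c hy))
    simp only [map_add, LinearMap.map_smulₛₗ, LinearMap.add_apply, LinearMap.smul_apply, h x hx,
      h y hy, RingHom.id_apply, smul_eq_mul, mul_zero, add_zero, zero_add] at h1
    linear_combination h1
  have h1 := key 1
  rw [map_one, one_mul, one_mul] at h1
  have h2 : (τ a - a) * H.form (A x) y = 0 := by linear_combination key a - a * h1
  rcases mul_eq_zero.1 h2 with h3 | h3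
  · exact ha (sub_eq_zero.1 h3)
  · exact hxy h3

end HermitianAdjoint

end Hermitian

section Unitary

open Polynomial

/-- The residue field of an irreducible factor of the minimal polynomial acts on the
corresponding primary component. -/
lemma exists_adjoinRoot_action {F V : Type*} [Field F] [AddCommGroup V] [Module F V]
    {s : End F V} {m : ℕ} (hs : s ^ m = 1) {f b : F[X]} (hfb : X ^ m - 1 ∣ f * b)
    (hb : f ∣ b - 1) :
    ∃ ψ : AdjoinRoot f →ₗ[F] End F V,
      (∀ g, ψ (AdjoinRoot.mk f g) = aeval s g * aeval s b) ∧
      ∀ a c, ψ (a * c) = ψ a * ψ c := by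
  have hf0 : aeval s f * aeval s b = 0 := by
    obtain ⟨r, hr⟩ := hfb
    rw [← map_mul, hr, map_mul, map_sub, map_pow, aeval_X, hs, map_one, sub_self, zero_mul]
  have hbb : aeval s b * aeval s b = aeval s b := by
    obtain ⟨r, hr⟩ := hb
    have h1 : b = 1 + f * r := by rw [← hr]; ring
    have h2 : aeval s r * (aeval s f * aeval s b) = 0 := by rw [hf0, mul_zero]
    calc aeval s b * aeval s b = aeval s ((1 + f * r) * b) := by rw [← h1, map_mul]
      _ = aeval s b + aeval s r * (aeval s f * aeval s b) := by
        rw [← map_mul, ← map_mul, ← map_add]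
        congr 1
        ring
      _ = aeval s b := by rw [h2, add_zero]
  let ψ : AdjoinRoot f →ₗ[F] End F V :=
    Submodule.liftQ ((Ideal.span {f}).restrictScalars F)
      ((LinearMap.mulRight F (aeval s b)) ∘ₗ (aeval s).toLinearMap) (by
        intro g hg
        rw [Submodule.restrictScalars_mem, Ideal.mem_span_singleton'] at hg
        obtain ⟨r, rfl⟩ := hg
        change aeval s (r * f) * aeval s b = 0
        rw [map_mul, mul_assoc, hf0, mul_zero])
  have hψ : ∀ g, ψ (AdjoinRoot.mk f g) = aeval s g * aeval s b := fun g => rfl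
  refine ⟨ψ, hψ, fun a c => ?_⟩
  obtain ⟨a, rfl⟩ := AdjoinRoot.mk_surjective a
  obtain ⟨c, rfl⟩ := AdjoinRoot.mk_surjective c
  rw [← map_mul, hψ, hψ, hψ, map_mul]
  have hc : Commute (aeval s b) (aeval s c) := (Commute.all b c).map (aeval s)
  rw [mul_assoc (aeval s a) (aeval s b), ← mul_assoc (aeval s b), hc.eq, mul_assoc (aeval s c),
    hbb, mul_assoc]

variable {F V : Type*} [Field F] {τ : F →+* F} [AddCommGroup V] [Module F V]
  (H : HermitianAdjoint τ V)

lemma HermitianAdjoint.commute_adj_of_bicommutant {s u T Z : End F V}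
    (hs : H.adj s * s = 1) (hs' : s * H.adj s = 1) (hu : H.adj u * u = 1) (hu' : u * H.adj u = 1)
    (hT : ∀ Z, Commute Z s → Commute Z u → Commute T Z) (hZs : Commute Z s) (hZu : Commute Z u) :
    Commute (H.adj T) Z := by
  have h := H.commute_adj (hT _ (H.commute_adj_of_isometry hs hs' hZs)
    (H.commute_adj_of_isometry hu hu' hZu))
  rwa [H.adj_adj] at h

/-- An element of the centralizer acting as `T` on the image of `e` is normal. -/
lemma HermitianAdjoint.commute_adj_one_add {s u T e : End F V}
    (hs : H.adj s * s = 1) (hs' : s * H.adj s = 1) (hu : H.adj u * u = 1) (hu' : u * H.adj u = 1)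
    (hT : ∀ Z, Commute Z s → Commute Z u → Commute T Z) (hTs : Commute T s) (hTu : Commute T u)
    (hes : Commute e s) (heu : Commute e u) (hee : Commute e (H.adj e)) :
    Commute (1 + (T - 1) * e) (H.adj (1 + (T - 1) * e)) := by
  have h1 := H.commute_adj_of_isometry hs hs' hes
  have h2 := H.commute_adj_of_isometry hu hu' heu
  have h3 : Commute (H.adj T) e := H.commute_adj_of_bicommutant hs hs' hu hu' hT hes heu
  have h4 : Commute (H.adj T) T := H.commute_adj_of_bicommutant hs hs' hu hu' hT hTs hTu
  have h5 : Commute T (H.adj e) := hT _ h1 h2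
  rw [H.adj_add, H.adj_one, H.adj_mul, H.adj_sub, H.adj_one]
  refine (Commute.one_left _).add_left ((Commute.one_right _).add_right ?_)
  refine Commute.mul_left (Commute.mul_right ?_ ?_) (Commute.mul_right hee ?_)
  · exact h5.sub_left (Commute.one_left _)
  · exact (h4.symm.sub_left (Commute.one_left _)).sub_right (Commute.one_right _)
  · exact h3.symm.sub_right (Commute.one_right _)

lemma HermitianAdjoint.adj_eq_self_of_range {e : End F V} (hee : e * e = e) {v : V}
    (he : ∀ x, H.form (e x) v = H.form x v)
    (hr : ∀ x, ∃ T : End F V, e x = T v ∧ Commute (H.adj T) e) : H.adj e = e := by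
  have key : ∀ x y, H.form (e x) y = H.form (e x) (e y) := fun x y => by
    obtain ⟨T, hT, hc⟩ := hr x
    rw [← sub_eq_zero, ← map_sub, hT, H.form_adj, H.form_symm, ← he]
    have : e (H.adj T (y - e y)) = 0 := by
      rw [← Module.End.mul_apply, ← hc.eq, Module.End.mul_apply, map_sub,
        ← Module.End.mul_apply, hee, sub_self, map_zero]
    rw [this, map_zero, LinearMap.zero_apply, map_zero]
  refine H.adj_eq_of fun x y => ?_
  rw [key, H.form_symm (e y), ← key, ← H.form_symm]

/-- A Jordan block of length `i` of the unipotent part, in the primary component cut out by `b`,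
gives a normal element of the centralizer with any given `i`-th power as determinant. -/
lemma HermitianAdjoint.exists_normal_det_eq_pow [Finite F] [FiniteDimensional F V]
    (hτ : ∃ a, τ a ≠ a) {s u : End F V} (hs : H.adj s * s = 1) (hs' : s * H.adj s = 1)
    (hu : H.adj u * u = 1) (hu' : u * H.adj u = 1) (hsu : Commute s u) {m : ℕ} (hm : 0 < m)
    (hsm : s ^ m = 1) {f b : F[X]} (hf : Irreducible f) (hfb : X ^ m - 1 ∣ f * b)
    (hb : f ∣ b - 1) {i : ℕ} (hi : 0 < i) {x : V} (hx : ((u - 1) ^ i) (aeval s b x) = 0)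
    (hx' : ((u - 1) ^ (i - 1)) (aeval s b x) ∉ LinearMap.range ((u - 1) ^ i))
    {β : F} :
    ∃ y : End F V, Commute y s ∧ Commute y u ∧ Commute y (H.adj y) ∧
      LinearMap.det y = β ^ i := by
  obtain ⟨ψ, hψ, hψm⟩ := exists_adjoinRoot_action hsm hfb hb
  have : Fact (Irreducible f) := ⟨hf⟩
  have : FiniteDimensional F (AdjoinRoot f) := (AdjoinRoot.powerBasis hf.ne_zero).finite
  have : Finite (AdjoinRoot f) := Module.finite_of_finite F
  obtain ⟨α, hα⟩ := FiniteField.norm_surjective F (AdjoinRoot f) β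
  set N := u - 1 with hN
  set P := aeval s b with hP
  have hψ1 : ψ 1 = P := by
    rw [← map_one (AdjoinRoot.mk f), hψ, map_one, one_mul]
  have hPP : P * P = P := by rw [← hψ1, ← hψm, one_mul]
  -- polynomials in `s` and `u` lie in the bicommutant
  have hbs : ∀ (g : F[X]) (Z : End F V), Commute Z s → Commute (aeval s g) Z := fun g Z hZ =>
    Polynomial.induction_on' g
      (fun p q hp hq => by rw [map_add]; exact hp.add_left hq)
      (fun r a => by
        rw [aeval_monomial]
        exact (show Commute _ Z from Algebra.commutes a Z).mul_left (hZ.symm.pow_left r))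
  have hψZ : ∀ a (Z : End F V), Commute Z s → Commute (ψ a) Z := fun a Z hZ => by
    obtain ⟨g, rfl⟩ := AdjoinRoot.mk_surjective a
    rw [hψ]
    exact (hbs g Z hZ).mul_left (hbs b Z hZ)
  have hNs : Commute N s := hsu.symm.sub_left (Commute.one_left s)
  have hNψ : ∀ a, Commute N (ψ a) := fun a => (hψZ a N hNs).symm
  have hNu : Commute N u := (Commute.refl u).sub_left (Commute.one_left u)
  have hNP : ∀ k y, P ((N ^ k) y) = (N ^ k) (P y) := fun k y => by
    rw [← Module.End.mul_apply, ← Module.End.mul_apply, ((hbs b N hNs).pow_right k).eq]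
  -- the adjoint of `N`
  have hadjN : H.adj N = - (H.adj u * N) := by
    rw [hN, H.adj_sub, H.adj_one, mul_sub, hu, mul_one, neg_sub]
  have hadjNu : Commute (H.adj u) N :=
    (H.commute_adj_of_bicommutant hs hs' hu hu' (fun Z _ hZ => hZ.symm) hNs hNu)
  have hadjNk : ∀ k y, (N ^ k) y = 0 ↔ (H.adj (N ^ k)) y = 0 := fun k y => by
    rw [H.adj_pow, hadjN, neg_pow, hadjNu.mul_pow]
    have h1 : (u ^ k) * (H.adj u ^ k) = 1 := by
      rw [← (show Commute u (H.adj u) from hu'.trans hu.symm).mul_pow, hu', one_pow]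
    constructor
    · intro h
      rw [Module.End.mul_apply, Module.End.mul_apply, h, map_zero, map_zero]
    · intro h
      have h2 : (u ^ k * ((-1) ^ k * ((-1) ^ k * (H.adj u ^ k * N ^ k)))) y = 0 := by
        rw [Module.End.mul_apply, Module.End.mul_apply, h, map_zero, map_zero]
      rwa [← mul_assoc ((-1 : End F V) ^ k), ← pow_add, (Even.add_self k).neg_one_pow, one_mul,
        ← mul_assoc, h1, one_mul] at h2
  -- the adjoint of `P`
  have hPv : P (P x) = P x := by rw [← Module.End.mul_apply, hPP]
  have hPne : P ≠ 0 := fun h => hx' (by rw [h, LinearMap.zero_apply, map_zero]; exact zero_mem _)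
  have hψinj : ∀ a, ψ a = 0 → a = 0 := fun a ha => by
    by_contra h
    refine hPne ?_
    rw [← hψ1, ← inv_mul_cancel₀ h, hψm, ha, mul_zero]
  have hadjs : H.adj s = s ^ (m - 1) := by
    calc H.adj s = H.adj s * s ^ m := by rw [hsm, mul_one]
      _ = H.adj s * s * s ^ (m - 1) := by rw [mul_assoc, ← pow_succ', Nat.sub_add_cancel hm]
      _ = s ^ (m - 1) := by rw [hs, one_mul]
  have hadjP : ∃ g : F[X], H.adj P = aeval s g := by
    refine ⟨(b.map τ).comp (X ^ (m - 1)), ?_⟩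
    rw [hP, H.adj_aeval, hadjs, aeval_comp, map_pow, aeval_X]
  obtain ⟨g, hg⟩ := hadjP
  have hcomm : Commute (H.adj P) P := by
    rw [hg]
    exact (Commute.all g b).map (aeval s)
  have hcase : H.adj P = P ∨ H.adj P * P = 0 := by
    have h1 : ψ (AdjoinRoot.mk f g) = H.adj P * P := by rw [hψ, hg]
    have h2 : (H.adj P * P) * (H.adj P * P) = H.adj P * P := by
      rw [hcomm.symm.mul_mul_mul_comm, hPP, ← H.adj_mul, hPP]
    have h3 : AdjoinRoot.mk f g * AdjoinRoot.mk f g - AdjoinRoot.mk f g = 0 :=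
      hψinj _ (by rw [map_sub, hψm, h1, h2, sub_self])
    have h4 : AdjoinRoot.mk f g * (AdjoinRoot.mk f g - 1) = 0 := by
      rw [mul_sub, mul_one, h3]
    rcases mul_eq_zero.1 h4 with h5 | h5
    · right
      rw [← h1, h5, map_zero]
    · left
      rw [sub_eq_zero.1 h5, hψ1] at h1
      have h6 := congrArg H.adj h1
      rw [H.adj_mul, H.adj_adj, ← h1] at h6
      exact h6
  obtain ⟨v, w, hv, hNv, hw, hNw, hvw, hvform⟩ : ∃ (v : V) (w : V →ₗ[F] F), P v = v ∧
      (N ^ i) v = 0 ∧ (∀ y, w (P y) = w y) ∧ (∀ y, w ((N ^ i) y) = 0) ∧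
      w ((N ^ (i - 1)) v) ≠ 0 ∧ (H.adj P = P → ∀ y, H.form y v = w y) := by
    obtain ⟨w₁, hw₁, hw₁'⟩ := Submodule.exists_le_ker_of_notMem hx'
    have hw₁N : ∀ y, w₁ ((N ^ i) y) = 0 := fun y => hw₁' ⟨y, rfl⟩
    have h1 : ∀ y, (w₁ ∘ₗ P) (P y) = (w₁ ∘ₗ P) y := fun y => by
      rw [LinearMap.comp_apply, LinearMap.comp_apply, ← Module.End.mul_apply, hPP]
    have h2 : ∀ y, (w₁ ∘ₗ P) ((N ^ i) y) = 0 := fun y => by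
      rw [LinearMap.comp_apply, hNP, hw₁N]
    have h3 : (w₁ ∘ₗ P) ((N ^ (i - 1)) (P x)) ≠ 0 := by
      rwa [LinearMap.comp_apply, hNP, hPv]
    by_cases hadj : H.adj P = P
    · obtain ⟨y, hy⟩ := H.riesz (w₁ ∘ₗ P)
      let W : Submodule F V := LinearMap.ker (N ^ i) ⊓ LinearMap.ker (P - 1)
      have hW : ∀ z, z ∈ W ↔ (N ^ i) z = 0 ∧ P z = z := fun z => by
        rw [Submodule.mem_inf, LinearMap.mem_ker, LinearMap.mem_ker, LinearMap.sub_apply,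
          sub_eq_zero, Module.End.one_apply]
      have hyW : y ∈ W := by
        rw [hW, hadjNk]
        constructor
        · exact H.nondegenerate _ fun z => by rw [← H.form_adj, hy, h2]
        · rw [← sub_eq_zero]
          refine H.nondegenerate _ fun z => ?_
          rw [map_sub, hy, ← h1, ← hy (P z), H.form_adj, hadj, sub_self]
      have hxW : P x ∈ W := (hW _).2 ⟨hx, hPv⟩
      rw [← hy] at h3
      obtain ⟨v, hv, hvv⟩ := H.exists_form_self_ne_zero hτ W hxW hyW h3
      rw [hW] at hv
      have hflip : ∀ z, H.form.flip v z = H.form z v := fun z => rfl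
      refine ⟨v, H.form.flip v, hv.2, hv.1, fun z => ?_, fun z => ?_, hvv, fun _ z => rfl⟩
      · rw [hflip, hflip, H.form_adj, hadj, hv.2]
      · rw [hflip, H.form_adj, (hadjNk i v).1 hv.1, map_zero]
    · exact ⟨P x, w₁ ∘ₗ P, hPv, hx, h1, h2, h3, fun h => absurd h hadj⟩
  rw [← hψ1] at hv hw
  obtain ⟨e, hee, hev, hwe, hPe, heP, hNe, hψe, her, hdet⟩ :=
    exists_idempotent_of_block ψ hψm hNψ hi hv hNv hw hNw hvw
  rw [hψ1] at hPe heP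
  have hes : Commute e s := by
    have h1 : ψ (AdjoinRoot.mk f X) = s * P := by rw [hψ, aeval_X]
    have h2 : P * s = s * P := hbs b s (Commute.refl s)
    have h3 := (hψe (AdjoinRoot.mk f X)).eq
    rw [h1, mul_assoc, hPe, ← h2, ← mul_assoc, heP] at h3
    exact h3.symm
  have heu : Commute e u := by
    have h1 : u = N + 1 := by rw [hN, sub_add_cancel]
    rw [h1]
    exact hNe.symm.add_right (Commute.one_right e)
  have hadje : Commute e (H.adj e) := by
    rcases hcase with hc | hc
    · have h1 : H.adj e = e := by
        refine H.adj_eq_self_of_range hee (v := v) (fun z => ?_) fun z => ?_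
        · rw [hvform hc, hvform hc, hwe]
        · obtain ⟨c, hz⟩ := her z
          refine ⟨∑ j : Fin i, N ^ (j : ℕ) * ψ (c j), ?_, ?_⟩
          · rw [hz, LinearMap.sum_apply]
            rfl
          · refine H.commute_adj_of_bicommutant hs hs' hu hu' (fun Z hZs hZu => ?_) hes heu
            refine Commute.sum_left _ _ _ fun j _ => Commute.mul_left ?_ (hψZ _ _ hZs)
            exact (hZu.symm.sub_left (Commute.one_left Z)).pow_left _
      rw [h1]
    · have h1 : H.adj P * H.adj e = H.adj e := by rw [← H.adj_mul, heP]
      have h2 : H.adj e * H.adj P = H.adj e := by rw [← H.adj_mul, hPe]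
      have h3 : e * H.adj e = 0 := by
        calc e * H.adj e = (e * P) * (H.adj P * H.adj e) := by rw [heP, h1]
          _ = e * (H.adj P * P) * H.adj e := by simp only [mul_assoc, hcomm.eq, h1]
          _ = 0 := by rw [hc, mul_zero, zero_mul]
      have h4 : H.adj e * e = 0 := by
        calc H.adj e * e = (H.adj e * H.adj P) * (P * e) := by rw [hPe, h2]
          _ = H.adj e * (H.adj P * P) * e := by simp only [mul_assoc]
          _ = 0 := by rw [hc, mul_zero, zero_mul]
      exact h3.trans h4.symm
  have hψs : Commute (ψ α) s := hψZ α s (Commute.refl s)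
  have hψu : Commute (ψ α) u := hψZ α u hsu.symm
  refine ⟨1 + (ψ α - 1) * e, ?_, ?_, ?_, ?_⟩
  · exact (Commute.one_left s).add_left ((hψs.sub_left (Commute.one_left s)).mul_left hes)
  · exact (Commute.one_left u).add_left ((hψu.sub_left (Commute.one_left u)).mul_left heu)
  · exact H.commute_adj_one_add hs hs' hu hu' (fun Z hZs _ => hψZ α Z hZs) hψs hψu hes heu hadje
  · rw [hdet, hα]

end Unitary

section BaseChange

open Polynomial

lemma LinearMap.exists_generalized_inverse {F V : Type*} [Field F] [AddCommGroup V] [Module F V]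
    (A : End F V) : ∃ B : End F V, A * B * A = A := by
  obtain ⟨g, hg⟩ := A.rangeRestrict.exists_rightInverse_of_surjective A.range_rangeRestrict
  obtain ⟨B, hB⟩ := LinearMap.exists_extend g
  refine ⟨B, LinearMap.ext fun x => ?_⟩
  have h1 : B (A x) = g (A.rangeRestrict x) := LinearMap.congr_fun hB (A.rangeRestrict x)
  have h2 := congrArg Subtype.val (LinearMap.congr_fun hg (A.rangeRestrict x))
  rw [Module.End.mul_apply, Module.End.mul_apply, h1]
  exact h2

/-- A solvability condition for linear equations turned into an identity. -/
lemma LinearMap.exists_eq_mul_add_mul {F V : Type*} [Field F] [AddCommGroup V] [Module F V]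
    {A C D : End F V} (h : ∀ x, A x = 0 → C x ∈ LinearMap.range D) :
    ∃ X Y : End F V, C = D * Y + X * A := by
  obtain ⟨A', hA⟩ := LinearMap.exists_generalized_inverse A
  obtain ⟨D', hD⟩ := LinearMap.exists_generalized_inverse D
  refine ⟨C * A', D' * (C * (1 - A' * A)), ?_⟩
  have h1 : D * (D' * (C * (1 - A' * A))) = C * (1 - A' * A) := by
    refine LinearMap.ext fun x => ?_
    have hx : A ((1 - A' * A) x) = 0 := by
      rw [← Module.End.mul_apply, mul_sub, mul_one, ← mul_assoc, hA, sub_self,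
        LinearMap.zero_apply]
    obtain ⟨y, hy⟩ := h _ hx
    have h2 : (D * D' * D) y = D y := by rw [hD]
    rw [Module.End.mul_apply, Module.End.mul_apply, Module.End.mul_apply, ← hy]
    exact h2
  rw [h1]
  noncomm_ring

/-- Extension of scalars for endomorphisms of the standard space. -/
noncomputable def endBaseChange (F K : Type*) [Field F] [Field K] [Algebra F K] (n : ℕ) :
    End F (Fin n → F) →ₐ[F] End K (Fin n → K) :=
  ((Matrix.toLinAlgEquiv' (R := K) (n := Fin n)).toAlgHom.restrictScalars F).comp
    ((Algebra.ofId F K).mapMatrix.comp (LinearMap.toMatrixAlgEquiv' (R := F) (n := Fin n)))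

variable {F K : Type*} [Field F] [Field K] [Algebra F K] {n : ℕ}

lemma endBaseChange_toLin' (A : Matrix (Fin n) (Fin n) F) :
    endBaseChange F K n (Matrix.toLin' A) = Matrix.toLin' (A.map (algebraMap F K)) := by
  change Matrix.toLin' ((LinearMap.toMatrix' (Matrix.toLin' A)).map (algebraMap F K)) = _
  rw [LinearMap.toMatrix'_toLin']

lemma aeval_apply_eigenvector {V : Type*} [AddCommGroup V] [Module K V] [Module F V]
    [IsScalarTower F K V] {S : End K V} {ξ : K} {v : V} (hv : S v = ξ • v) (b : F[X]) :
    (aeval S b) v = aeval ξ b • v := by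
  have hpow : ∀ k : ℕ, (S ^ k) v = ξ ^ k • v := fun k => by
    induction k with
    | zero => simp
    | succ k ih => rw [pow_succ, Module.End.mul_apply, hv, map_smul, ih, smul_smul, ← pow_succ']
  induction b using Polynomial.induction_on' with
  | add f g hf hg => rw [map_add, LinearMap.add_apply, hf, hg, map_add, add_smul]
  | monomial k a =>
    rw [aeval_monomial, aeval_monomial, Module.End.mul_apply, hpow, Module.algebraMap_end_apply,
      mul_smul, algebraMap_smul]

/-- A Jordan block over the big field is already visible in the corresponding primary component
over the small field. -/
lemma exists_block_of_not_noBlock {S N : End F (Fin n → F)} (hSN : Commute S N) {m : ℕ}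
    (hm : (m : F) ≠ 0) (hS : S ^ m = 1) {ξ : K} (hξ : ξ ^ m = 1) {b : F[X]}
    (hb : minpoly F ξ ∣ b - 1) {i : ℕ}
    (h : ¬ NoBlock (endBaseChange F K n N) ((endBaseChange F K n S).eigenspace ξ) i) :
    ∃ x, (N ^ i) (aeval S b x) = 0 ∧
      (N ^ (i - 1)) (aeval S b x) ∉ LinearMap.range (N ^ i) := by
  by_contra! hcon
  obtain ⟨X, Y, hXY⟩ := LinearMap.exists_eq_mul_add_mul (A := N ^ i * aeval S b)
    (C := N ^ (i - 1) * aeval S b) (D := N ^ i) hcon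
  refine h ?_
  set θ := endBaseChange F K n
  have hmK : (m : K) ≠ 0 := by
    rw [← map_natCast (algebraMap F K)]
    exact (_root_.map_ne_zero _).2 hm
  refine noBlock_eigenspace_of_identity (P := θ (aeval S b)) (X := θ X) (Y := θ Y) hmK
    (by rw [← map_pow, hS, map_one]) (hSN.map θ) hξ ?_ ?_
  · have := congrArg θ hXY
    simpa only [map_mul, map_add, map_pow] using this
  · intro v hv
    rw [Module.End.mem_eigenspace_iff] at hv
    rw [← aeval_algHom_apply, aeval_apply_eigenvector hv]
    have : aeval ξ (b - 1) = 0 := by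
      obtain ⟨r, hr⟩ := hb
      rw [hr, map_mul, minpoly.aeval, zero_mul]
    rw [map_sub, map_one, sub_eq_zero] at this
    rw [this, one_smul]

end BaseChange

section StandardForm

lemma w0Mat_mul_self (n : ℕ) (R : Type*) [CommRing R] : w0Mat n R * w0Mat n R = 1 := by
  ext i j
  rw [Matrix.mul_apply, Finset.sum_eq_single (Fin.rev i)]
  · simp [w0Mat, Matrix.one_apply, eq_comm]
  · intro k _ hk
    simp [w0Mat, hk]
  · simp

lemma w0Mat_transpose (n : ℕ) (R : Type*) [CommRing R] : (w0Mat n R)ᵀ = w0Mat n R := by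
  ext i j
  have : i = Fin.rev j ↔ j = Fin.rev i := by rw [← Fin.rev_eq_iff, eq_comm]
  simp only [w0Mat, Matrix.transpose_apply, Matrix.of_apply, this]

lemma w0Mat_map {n : ℕ} {R S : Type*} [CommRing R] [CommRing S] (τ : R →+* S) :
    (w0Mat n R).map τ = w0Mat n S := by
  ext i j
  simp [w0Mat, apply_ite τ]

lemma RingHom.comp_mulVec {n : ℕ} {R S : Type*} [CommRing R] [CommRing S] (τ : R →+* S)
    (A : Matrix (Fin n) (Fin n) R) (y : Fin n → R) :
    τ ∘ (A *ᵥ y) = A.map τ *ᵥ (τ ∘ y) :=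
  funext fun i => RingHom.map_mulVec τ A y i

variable {F : Type*} [Field F] (τ : F →+* F) (hτ : ∀ a, τ (τ a) = a) (n : ℕ)

/-- The standard hermitian form with Gram matrix `w₀`. -/
noncomputable def stdHermitian : HermitianAdjoint τ (Fin n → F) where
  form := LinearMap.mk₂'ₛₗ (RingHom.id F) τ (fun x y => x ⬝ᵥ w0Mat n F *ᵥ (τ ∘ y))
    (fun x y z => by rw [add_dotProduct])
    (fun c x y => by rw [smul_dotProduct, RingHom.id_apply])
    (fun x y z => by
      rw [← dotProduct_add, ← mulVec_add]
      congr 2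
      ext i
      simp)
    (fun c x y => by
      rw [← dotProduct_smul, ← mulVec_smul]
      congr 2
      ext i
      simp)
  adj A := Matrix.toLin' (w0Mat n F * ((LinearMap.toMatrix' A).map τ)ᵀ * w0Mat n F)
  involutive := hτ
  form_symm x y := by
    rw [LinearMap.mk₂'ₛₗ_apply, LinearMap.mk₂'ₛₗ_apply, RingHom.map_dotProduct,
      RingHom.comp_mulVec, w0Mat_map]
    have : τ ∘ τ ∘ y = y := funext fun i => hτ (y i)
    rw [this, dotProduct_mulVec, ← mulVec_transpose, w0Mat_transpose, dotProduct_comm]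
  nondegenerate y h := by
    have h1 : w0Mat n F *ᵥ (τ ∘ y) = 0 := by
      refine dotProduct_eq_zero _ fun x => ?_
      rw [dotProduct_comm]
      exact h x
    have h2 : w0Mat n F *ᵥ w0Mat n F *ᵥ (τ ∘ y) = 0 := by rw [h1, mulVec_zero]
    rw [mulVec_mulVec, w0Mat_mul_self, one_mulVec] at h2
    exact funext fun i => (map_eq_zero τ).1 (congrFun h2 i)
  riesz w := by
    refine ⟨τ ∘ (w0Mat n F *ᵥ fun i => w (Pi.single i 1)), fun x => ?_⟩
    have : τ ∘ τ ∘ (w0Mat n F *ᵥ fun i => w (Pi.single i 1)) =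
      w0Mat n F *ᵥ fun i => w (Pi.single i 1) := funext fun i => hτ _
    rw [LinearMap.mk₂'ₛₗ_apply, this, mulVec_mulVec, w0Mat_mul_self, one_mulVec, dotProduct]
    conv_rhs => rw [pi_eq_sum_univ' x]
    rw [map_sum]
    simp
  form_adj A x y := by
    obtain ⟨M, rfl⟩ := Matrix.toLin'.surjective A
    have hM : (Mᵀ.map τ).map τ = Mᵀ := by
      ext i j
      exact hτ (M j i)
    rw [LinearMap.mk₂'ₛₗ_apply, LinearMap.mk₂'ₛₗ_apply, LinearMap.toMatrix'_toLin',
      Matrix.toLin'_apply, Matrix.toLin'_apply, RingHom.comp_mulVec, Matrix.map_mul,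
      Matrix.map_mul, ← Matrix.transpose_map, hM, w0Mat_map, mulVec_mulVec, ← mul_assoc,
      ← mul_assoc, w0Mat_mul_self, one_mul, ← mulVec_mulVec, dotProduct_mulVec x,
      vecMul_transpose]

variable {τ hτ n}

lemma stdHermitian_adj_toLin' (M : Matrix (Fin n) (Fin n) F) :
    (stdHermitian τ hτ n).adj (Matrix.toLin' M) =
      Matrix.toLin' (w0Mat n F * (M.map τ)ᵀ * w0Mat n F) := by
  change Matrix.toLin' (w0Mat n F * ((LinearMap.toMatrix' (Matrix.toLin' M)).map τ)ᵀ
    * w0Mat n F) = _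
  rw [LinearMap.toMatrix'_toLin']

lemma det_stdHermitian_adj (A : End F (Fin n → F)) :
    LinearMap.det ((stdHermitian τ hτ n).adj A) = τ (LinearMap.det A) := by
  obtain ⟨M, rfl⟩ := Matrix.toLin'.surjective A
  have h : (w0Mat n F).det * (w0Mat n F).det = 1 := by
    rw [← Matrix.det_mul, w0Mat_mul_self, Matrix.det_one]
  have h2 : (M.map τ).det = τ M.det := (RingHom.map_det τ M).symm
  rw [stdHermitian_adj_toLin', LinearMap.det_toLin', LinearMap.det_toLin', Matrix.det_mul,
    Matrix.det_mul, Matrix.det_transpose, h2, mul_right_comm, h, one_mul]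

/-- The isometries of the standard hermitian form are the elements of `GU_n(q)`. -/
lemma isGU_iff {q : ℕ} [Fintype F] (hτq : ∀ a, τ a = a ^ q) (g : GL (Fin n) F) :
    IsGU q g ↔ (stdHermitian τ hτ n).adj (Matrix.toLin' (g : Matrix (Fin n) (Fin n) F)) *
      Matrix.toLin' (g : Matrix (Fin n) (Fin n) F) = 1 := by
  have hmap : (g : Matrix (Fin n) (Fin n) F).map (· ^ q) =
      (g : Matrix (Fin n) (Fin n) F).map τ := by
    ext i j
    exact (hτq _).symm
  have hJ := w0Mat_mul_self n F
  rw [IsGU, hmap, stdHermitian_adj_toLin']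
  set M := ((g : Matrix (Fin n) (Fin n) F).map τ)ᵀ with hMdef
  set J := w0Mat n F
  set G := (g : Matrix (Fin n) (Fin n) F) with hG
  have hM : IsUnit M.det := by
    rw [hMdef, Matrix.det_transpose, ← RingHom.mapMatrix_apply, ← RingHom.map_det]
    exact ((Matrix.isUnit_iff_isUnit_det _).1 g.isUnit).map τ
  rw [Module.End.mul_eq_comp, ← Matrix.toLin'_mul,
    show (1 : End F (Fin n → F)) = Matrix.toLin' 1 from Matrix.toLin'_one.symm,
    Matrix.toLin'.injective.eq_iff]
  constructor
  · intro h
    calc J * M * J * G = J * M * (J * J) * M⁻¹ * J := by rw [← h]; simp only [mul_assoc]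
      _ = J * (M * M⁻¹) * J := by rw [hJ, mul_one, mul_assoc J]
      _ = 1 := by rw [Matrix.mul_nonsing_inv _ hM, mul_one, hJ]
  · intro h
    have h1 : M * (J * G * J) = 1 := by
      calc M * (J * G * J) = J * J * M * J * G * J := by rw [hJ, one_mul]; simp only [mul_assoc]
        _ = J * (J * M * J * G) * J := by simp only [mul_assoc]
        _ = 1 := by rw [h, mul_one, hJ]
    rw [Matrix.inv_eq_right_inv h1]
    calc J * (J * G * J) * J = (J * J) * G * (J * J) := by simp only [mul_assoc]
      _ = G := by rw [hJ, one_mul, mul_one]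

end StandardForm

section CharpolyDual

lemma charpoly_map_eq_of_isometry {K : Type*} [Field K] {n : ℕ} {φ : K →+* K}
    {J G : Matrix (Fin n) (Fin n) K} (hJ : J * J = 1) (h : J * (G.map φ)ᵀ * J * G = 1) :
    ∃ c, G.charpoly.map φ = Polynomial.C c * G.charpoly.reverse := by
  have hG : (G.map φ)ᵀ = J * (G⁻¹ * J) := by
    rw [Matrix.inv_eq_left_inv h]
    calc (G.map φ)ᵀ = (J * J) * (G.map φ)ᵀ * (J * J) := by rw [hJ, one_mul, mul_one]
      _ = _ := by simp only [mul_assoc]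
  have hu : IsUnit G := by
    rw [Matrix.isUnit_iff_isUnit_det]
    exact Matrix.isUnit_det_of_left_inverse h
  refine ⟨(-1) ^ n * Ring.inverse G.det, ?_⟩
  rw [← Matrix.charpoly_map, ← Matrix.charpoly_transpose, hG, Matrix.charpoly_mul_comm, mul_assoc,
    hJ, mul_one, Matrix.charpoly_inv _ hu, Matrix.reverse_charpoly, Fintype.card_fin]
  simp

lemma det_pow_eq_one_of_dvd_rootMultiplicity {K : Type*} [Field K] [IsAlgClosed K] {n q d : ℕ}
    {φ : K →+* K} (hφ : ∀ x, φ x = x ^ q) {J G : Matrix (Fin n) (Fin n) K} (hJ : J * J = 1)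
    (h : J * (G.map φ)ᵀ * J * G = 1) (hd : 0 < d) (hdq : d ∣ q + 1)
    (hroot : ∀ a, d ∣ G.charpoly.rootMultiplicity a) : G.det ^ ((q + 1) / d) = 1 := by
  obtain ⟨c, hc⟩ := charpoly_map_eq_of_isometry hJ h
  obtain ⟨Q, hQ, hGQ⟩ := exists_monic_pow_eq_of_dvd_rootMultiplicity G.charpoly_monic hroot
  rw [hGQ] at hc
  have h0 := coeff_zero_pow_eq_one_of_selfDual hφ hQ hd hc
  have hn : n = d * Q.natDegree := by
    have := G.charpoly_natDegree_eq_dim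
    rw [hGQ, Polynomial.natDegree_pow, Fintype.card_fin] at this
    exact this.symm
  have hneg : ((-1 : K)) ^ (q + 1) = 1 := by
    rw [pow_succ, ← hφ, map_neg, map_one, neg_one_mul, neg_neg]
  have hdet : G.det = ((-1) ^ Q.natDegree * Q.coeff 0) ^ d := by
    rw [Matrix.det_eq_sign_charpoly_coeff, hGQ, Fintype.card_fin, mul_pow, ← pow_mul,
      mul_comm _ d, ← hn, Polynomial.coeff_zero_eq_eval_zero, Polynomial.eval_pow,
      ← Polynomial.coeff_zero_eq_eval_zero]
  rw [hdet, ← pow_mul, Nat.mul_div_cancel' hdq, mul_pow, h0, mul_one, ← pow_mul,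
    mul_comm, pow_mul, hneg, one_pow]

end CharpolyDual

section Isometry

variable {F : Type*} [Field F] {τ : F →+* F} {n : ℕ}

/-- The group of isometries of a hermitian form. -/
def HermitianAdjoint.isometryGroup (H : HermitianAdjoint τ (Fin n → F)) :
    Subgroup (GL (Fin n) F) where
  carrier := {g | H.adj (Matrix.toLin' (g : Matrix (Fin n) (Fin n) F)) *
    Matrix.toLin' (g : Matrix (Fin n) (Fin n) F) = 1}
  one_mem' := by
    rw [Set.mem_ofPred_eq, Units.val_one, Matrix.toLin'_one]
    exact H.adj_one
  mul_mem' {a b} ha hb := by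
    rw [Set.mem_ofPred_eq] at ha hb ⊢
    rw [Units.val_mul, Matrix.toLin'_mul, ← Module.End.mul_eq_comp, H.adj_mul, mul_assoc,
      ← mul_assoc (H.adj (Matrix.toLin' (a : Matrix (Fin n) (Fin n) F))), ha, one_mul, hb]
  inv_mem' {a} ha := by
    rw [Set.mem_ofPred_eq] at ha ⊢
    have h1 : Matrix.toLin' (a : Matrix (Fin n) (Fin n) F) *
        Matrix.toLin' ((a⁻¹ : GL (Fin n) F) : Matrix (Fin n) (Fin n) F) = 1 := by
      rw [Module.End.mul_eq_comp, ← Matrix.toLin'_mul, ← Units.val_mul, mul_inv_cancel]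
      exact Matrix.toLin'_one
    have h2 : H.adj (Matrix.toLin' (a : Matrix (Fin n) (Fin n) F)) =
        Matrix.toLin' ((a⁻¹ : GL (Fin n) F) : Matrix (Fin n) (Fin n) F) := by
      rw [← mul_one (H.adj _), ← h1, ← mul_assoc, ha, one_mul]
    rw [← h2, H.adj_adj, h2, h1]

variable {H : HermitianAdjoint τ (Fin n → F)}

lemma HermitianAdjoint.mem_isometryGroup {g : GL (Fin n) F} : g ∈ H.isometryGroup ↔
    H.adj (Matrix.toLin' (g : Matrix (Fin n) (Fin n) F)) *
      Matrix.toLin' (g : Matrix (Fin n) (Fin n) F) = 1 := Iff.rfl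

lemma commute_toLin' {a b : GL (Fin n) F} (h : Commute a b) :
    Commute (Matrix.toLin' (a : Matrix (Fin n) (Fin n) F))
      (Matrix.toLin' (b : Matrix (Fin n) (Fin n) F)) := by
  rw [commute_iff_eq, Module.End.mul_eq_comp, Module.End.mul_eq_comp, ← Matrix.toLin'_mul,
    ← Matrix.toLin'_mul, ← Units.val_mul, ← Units.val_mul, h.eq]

lemma exists_toLin'_eq {y : End F (Fin n → F)} (hy : LinearMap.det y ≠ 0) :
    ∃ Y : GL (Fin n) F, Matrix.toLin' (Y : Matrix (Fin n) (Fin n) F) = y := by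
  rw [← LinearMap.det_toMatrix'] at hy
  exact ⟨GeneralLinearGroup.mkOfDetNeZero _ hy, Matrix.toLin'_toMatrix' y⟩

/-- A normal invertible element `y` gives the isometry `y * (y^*)⁻¹`. -/
lemma HermitianAdjoint.exists_isometry_of_normal
    (hdet : ∀ A, LinearMap.det (H.adj A) = τ (LinearMap.det A))
    {y : End F (Fin n → F)} (hy : LinearMap.det y ≠ 0) (hyy : Commute y (H.adj y)) :
    ∃ g ∈ H.isometryGroup,
      (g : Matrix (Fin n) (Fin n) F).det * τ (LinearMap.det y) = LinearMap.det y ∧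
      ∀ h ∈ H.isometryGroup, Commute y (Matrix.toLin' (h : Matrix (Fin n) (Fin n) F)) →
        Commute g h := by
  have hy' : LinearMap.det (H.adj y) ≠ 0 := by
    rw [hdet]
    exact (map_ne_zero τ).2 hy
  obtain ⟨Y, hY⟩ := exists_toLin'_eq hy
  obtain ⟨Z, hZ⟩ := exists_toLin'_eq hy'
  have hinj : ∀ {a b : GL (Fin n) F}, Matrix.toLin' (a : Matrix (Fin n) (Fin n) F) =
      Matrix.toLin' (b : Matrix (Fin n) (Fin n) F) → a = b := fun hab =>
    Units.ext (Matrix.toLin'.injective hab)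
  have hmul : ∀ a b : GL (Fin n) F, Matrix.toLin' ((a * b : GL (Fin n) F) :
      Matrix (Fin n) (Fin n) F) = Matrix.toLin' (a : Matrix (Fin n) (Fin n) F) *
        Matrix.toLin' (b : Matrix (Fin n) (Fin n) F) := fun a b => by
    rw [Units.val_mul, Matrix.toLin'_mul, Module.End.mul_eq_comp]
  have hcom : ∀ {a b : GL (Fin n) F}, Commute (Matrix.toLin' (a : Matrix (Fin n) (Fin n) F))
      (Matrix.toLin' (b : Matrix (Fin n) (Fin n) F)) → Commute a b := fun {a b} hab =>
    hinj (by rw [hmul, hmul, hab.eq])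
  have hYZ : Commute Y Z := hcom (by rw [hY, hZ]; exact hyy)
  have hgZ : Y * Z⁻¹ * Z = Y := inv_mul_cancel_right Y Z
  refine ⟨Y * Z⁻¹, ?_, ?_, ?_⟩
  · rw [HermitianAdjoint.mem_isometryGroup]
    set t := Matrix.toLin' ((Y * Z⁻¹ : GL (Fin n) F) : Matrix (Fin n) (Fin n) F)
    have h1 : t * H.adj y = y := by rw [← hZ, ← hmul, hgZ, hY]
    have h2 : y * H.adj t = H.adj y := by
      have := congrArg H.adj h1
      rwa [H.adj_mul, H.adj_adj] at this
    have h3 : y * (H.adj t * t) * H.adj y = y * H.adj y := by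
      rw [← mul_assoc, h2, mul_assoc, h1, hyy.eq]
    have hyu : IsUnit y := (LinearMap.isUnit_iff_isUnit_det y).2 hy.isUnit
    have hyu' : IsUnit (H.adj y) := (LinearMap.isUnit_iff_isUnit_det _).2 hy'.isUnit
    have h4 := hyu'.mul_right_cancel h3
    exact hyu.mul_left_cancel (by rw [h4, mul_one])
  · rw [← hdet, ← hZ, ← LinearMap.det_toLin', ← map_mul, ← hmul, hgZ, hY]
  · intro h hh hc
    have h1 : Commute Y h := hcom (by rw [hY]; exact hc)
    have h2 : Commute Z h := by
      refine hcom ?_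
      rw [hZ]
      have h3 := H.commute_adj hc
      have h4 := (H.mem_isometryGroup).1 hh
      have h5 : H.adj (Matrix.toLin' (h : Matrix (Fin n) (Fin n) F)) =
          Matrix.toLin' ((h⁻¹ : GL (Fin n) F) : Matrix (Fin n) (Fin n) F) := by
        have h6 : Matrix.toLin' (h : Matrix (Fin n) (Fin n) F) *
            Matrix.toLin' ((h⁻¹ : GL (Fin n) F) : Matrix (Fin n) (Fin n) F) = 1 := by
          rw [← hmul, mul_inv_cancel, Units.val_one]
          exact Matrix.toLin'_one
        rw [← mul_one (H.adj _), ← h6, ← mul_assoc, h4, one_mul]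
      rw [h5, ← hZ] at h3
      have h7 := (hcom h3).inv_right
      rw [inv_inv] at h7
      rw [← hZ]
      exact commute_toLin' h7
    exact h1.mul_left h2.inv_left

end Isometry

section Group

lemma Commute.mem_zpowers_mul_of_coprime {G : Type*} [Group G] {s u : G} (h : Commute s u)
    (hc : (orderOf s).Coprime (orderOf u)) : s ∈ Subgroup.zpowers (s * u) := by
  obtain ⟨k, hk1, hk2⟩ := Nat.chineseRemainder hc 1 0
  refine ⟨k, ?_⟩
  have h1 : s ^ k = s ^ 1 := pow_eq_pow_iff_modEq.2 hk1
  have h2 : u ^ k = u ^ 0 := pow_eq_pow_iff_modEq.2 hk2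
  change (s * u) ^ (k : ℤ) = s
  rw [zpow_natCast, h.mul_pow, h1, h2, pow_one, pow_zero, mul_one]

lemma exists_pow_prime_pow_eq_one {n p : ℕ} [Fact p.Prime] {F : Type*} [Field F] [CharP F p]
    [NeZero n] {u : GL (Fin n) F} (hu : IsNilpotent ((u : Matrix (Fin n) (Fin n) F) - 1)) :
    ∃ r, u ^ p ^ r = 1 := by
  obtain ⟨M, hM⟩ := hu
  refine ⟨M, Units.ext ?_⟩
  have h1 := sub_pow_char_pow_of_commute p M (Commute.one_right (u : Matrix (Fin n) (Fin n) F))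
  rw [pow_eq_zero_of_le (Nat.lt_pow_self (Fact.out : p.Prime).one_lt).le hM, one_pow] at h1
  rw [Units.val_pow_eq_pow_val, Units.val_one]
  exact (sub_eq_zero.1 h1.symm)

end Group

section Diagonal

variable {F : Type*} [Field F] {τ : F →+* F} {hτ : ∀ a, τ (τ a) = a} {n : ℕ}

lemma w0Mat_mul_diagonal_mul (v : Fin n → F) :
    w0Mat n F * Matrix.diagonal v * w0Mat n F = Matrix.diagonal (v ∘ Fin.rev) := by
  have h : w0Mat n F * Matrix.diagonal v = Matrix.diagonal (v ∘ Fin.rev) * w0Mat n F := by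
    ext i j
    rw [Matrix.mul_diagonal, Matrix.diagonal_mul]
    by_cases hij : j = Fin.rev i
    · simp [w0Mat, hij]
    · simp [w0Mat, hij]
  rw [h, mul_assoc, w0Mat_mul_self, mul_one]

lemma exists_normal_det_eq [NeZero n] (β : F) : ∃ y : End F (Fin n → F),
    Commute y ((stdHermitian τ hτ n).adj y) ∧ LinearMap.det y = β := by
  refine ⟨Matrix.toLin' (Matrix.diagonal (Pi.mulSingle 0 β)), ?_, ?_⟩
  · rw [stdHermitian_adj_toLin', Matrix.diagonal_map (map_zero τ), Matrix.diagonal_transpose,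
      w0Mat_mul_diagonal_mul, commute_iff_eq, Module.End.mul_eq_comp, Module.End.mul_eq_comp,
      ← Matrix.toLin'_mul, ← Matrix.toLin'_mul, (Matrix.commute_diagonal _ _).eq]
  · rw [LinearMap.det_toLin', Matrix.det_diagonal, Finset.prod_pi_mulSingle']
    simp

end Diagonal

section Centralizer

open Polynomial

lemma pow_eq_one_of_hasEigenvalue {K V : Type*} [Field K] [AddCommGroup V] [Module K V]
    {S : End K V} {m : ℕ} (hS : S ^ m = 1) {ξ : K} (h : S.HasEigenvalue ξ) : ξ ^ m = 1 := by
  obtain ⟨v, hv⟩ := h.exists_hasEigenvector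
  have h1 := aeval_apply_eigenvector (F := K) hv.apply_eq_smul (X ^ m - 1)
  simp only [map_sub, map_pow, aeval_X, map_one, hS, sub_self, LinearMap.zero_apply] at h1
  exact sub_eq_zero.1 ((smul_eq_zero.1 h1.symm).resolve_right hv.2)

variable {F K : Type*} [Field F] [Field K] [Algebra F K] {n : ℕ}

lemma glToEnd_eq (g : GL (Fin n) F) : glToEnd (K := K) g =
    endBaseChange F K n (Matrix.toLin' (g : Matrix (Fin n) (Fin n) F)) :=
  (endBaseChange_toLin' _).symm

lemma commute_glToEnd {a b : GL (Fin n) F} (h : Commute a b) :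
    Commute (glToEnd (K := K) a) (glToEnd (K := K) b) := by
  rw [glToEnd_eq, glToEnd_eq]
  exact (commute_toLin' h).map _

lemma toLin'_pow_eq_one {g : GL (Fin n) F} {m : ℕ} (h : g ^ m = 1) :
    Matrix.toLin' (g : Matrix (Fin n) (Fin n) F) ^ m = 1 := by
  rw [← Matrix.toLin'_pow, ← Units.val_pow_eq_pow_val, h, Units.val_one]
  exact Matrix.toLin'_one

lemma glToEnd_pow_eq_one {g : GL (Fin n) F} {m : ℕ} (h : g ^ m = 1) :
    glToEnd (K := K) g ^ m = 1 := by
  rw [glToEnd_eq, ← map_pow, toLin'_pow_eq_one h, map_one]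

lemma glToEnd_sub_one (u : GL (Fin n) F) : glToEnd (K := K) u - 1 =
    endBaseChange F K n (Matrix.toLin' (u : Matrix (Fin n) (Fin n) F) - 1) := by
  rw [glToEnd_eq, map_sub, map_one]

lemma isNilpotent_glToEnd_sub_one {u : GL (Fin n) F}
    (hu : IsNilpotent ((u : Matrix (Fin n) (Fin n) F) - 1)) :
    IsNilpotent (glToEnd (K := K) u - 1) := by
  have h := hu.map (Matrix.toLinAlgEquiv' (R := F) (n := Fin n))
  rw [map_sub, map_one] at h
  rw [glToEnd_sub_one]
  exact h.map _

lemma mem_eigenspace_of_commute {V : Type*} [AddCommGroup V] [Module K V] {S N : End K V}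
    (h : Commute S N) (ξ : K) : ∀ x ∈ S.eigenspace ξ, N x ∈ S.eigenspace ξ := by
  intro x hx
  rw [Module.End.mem_eigenspace_iff] at hx ⊢
  rw [← Module.End.mul_apply, h.eq, Module.End.mul_apply, hx, map_smul]

/-- If the sizes of all Jordan blocks of `u` are divisible by `d`, then so is the exponent lost by
the determinant on the centralizer. -/
lemma det_pow_eq_one_of_commute [IsAlgClosed K] {q m d : ℕ} {τ : F →+* F}
    (hτq : ∀ a, τ a = a ^ q) {φ : K →+* K} (hφ : ∀ x, φ x = x ^ q) {s u g : GL (Fin n) F}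
    (hm : (m : K) ≠ 0) (hs : s ^ m = 1) (hsu : Commute s u)
    (hu : IsNilpotent ((u : Matrix (Fin n) (Fin n) F) - 1)) (hgu : Commute g u)
    (hg : w0Mat n F * ((g : Matrix (Fin n) (Fin n) F).map τ)ᵀ * w0Mat n F * g = 1)
    (hd : 0 < d) (hdq : d ∣ q + 1)
    (hN : ∀ k, ¬ d ∣ k → ∀ ξ, (glToEnd (K := K) s).HasEigenvalue ξ →
      NoBlock (glToEnd (K := K) u - 1) ((glToEnd (K := K) s).eigenspace ξ) k) :
    (g : Matrix (Fin n) (Fin n) F).det ^ ((q + 1) / d) = 1 := by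
  have hSN : Commute (glToEnd (K := K) s) (glToEnd (K := K) u - 1) :=
    (commute_glToEnd hsu).sub_right (Commute.one_right _)
  have hGN : Commute (glToEnd (K := K) g) (glToEnd (K := K) u - 1) :=
    (commute_glToEnd hgu).sub_right (Commute.one_right _)
  have htop : ∀ k, ¬ d ∣ k → NoBlock (glToEnd (K := K) u - 1) ⊤ k := fun k hk =>
    noBlock_top_of_eigenspaces hm (glToEnd_pow_eq_one hs) hSN (hN k hk)
  have hroot : ∀ a, d ∣ ((g : Matrix (Fin n) (Fin n) F).map
      (algebraMap F K)).charpoly.rootMultiplicity a := fun a => by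
    rw [← Matrix.charpoly_toLin', ← LinearMap.finrank_maxGenEigenspace_eq]
    refine dvd_finrank_of_noBlock (isNilpotent_glToEnd_sub_one hu) ?_ hd fun k hk =>
      noBlock_maxGenEigenspace hGN (htop k hk) a
    exact Module.End.mapsTo_maxGenEigenspace_of_comm hGN a
  have hiso := congrArg (fun M : Matrix (Fin n) (Fin n) F => M.map (algebraMap F K)) hg
  simp only [Matrix.map_mul, w0Mat_map, Matrix.transpose_map, Matrix.map_map] at hiso
  have hmap : (g : Matrix (Fin n) (Fin n) F).map (algebraMap F K ∘ τ) =
      ((g : Matrix (Fin n) (Fin n) F).map (algebraMap F K)).map φ := by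
    ext i j
    simp only [Matrix.map_apply, Function.comp_apply]
    rw [hτq, hφ, map_pow]
  rw [hmap, Matrix.map_one _ (map_zero _) (map_one _)] at hiso
  have h := det_pow_eq_one_of_dvd_rootMultiplicity hφ (w0Mat_mul_self n K) hiso hd hdq hroot
  refine (algebraMap F K).injective ?_
  rw [map_pow, map_one, RingHom.map_det]
  exact h

lemma HermitianAdjoint.mul_adj_eq_one {τ : F →+* F} {V : Type*} [AddCommGroup V] [Module F V]
    [FiniteDimensional F V] (H : HermitianAdjoint τ V) {A : End F V} (h : H.adj A * A = 1) :
    A * H.adj A = 1 := mul_eq_one_comm.1 h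

/-- A Jordan block of size `i` gives elements of the centralizer whose determinants are
`i`-th powers. -/
lemma exists_isometry_det_of_block [Finite F] {τ : F →+* F} {hτ : ∀ a, τ (τ a) = a}
    (hτ' : ∃ a, τ a ≠ a) {m : ℕ} {s u : GL (Fin n) F}
    (hs : s ∈ (stdHermitian τ hτ n).isometryGroup) (hu : u ∈ (stdHermitian τ hτ n).isometryGroup)
    (hsu : Commute s u) (hm : (m : F) ≠ 0) (hsm : s ^ m = 1) {ξ : K}
    (hξ : (glToEnd (K := K) s).HasEigenvalue ξ) {i : ℕ} (hi : 0 < i)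
    (hb : ¬ NoBlock (glToEnd (K := K) u - 1) ((glToEnd (K := K) s).eigenspace ξ) i)
    {β : F} (hβ : β ≠ 0) : ∃ g ∈ (stdHermitian τ hτ n).isometryGroup, Commute g s ∧ Commute g u ∧
      (g : Matrix (Fin n) (Fin n) F).det * τ (β ^ i) = β ^ i := by
  have hm0 : 0 < m := Nat.pos_of_ne_zero (by rintro rfl; simp at hm)
  have hξm := pow_eq_one_of_hasEigenvalue (glToEnd_pow_eq_one hsm) hξ
  have hint : IsIntegral F ξ := ⟨X ^ m - 1, monic_X_pow_sub_C 1 hm0.ne', by simp [hξm]⟩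
  obtain ⟨b, hfb, hb1⟩ := exists_projector_poly hm
    (minpoly.dvd F ξ (p := X ^ m - 1) (by simp [hξm]))
  rw [glToEnd_sub_one, glToEnd_eq] at hb
  have hSM := toLin'_pow_eq_one hsm
  have hSU := commute_toLin' hsu
  obtain ⟨x, hx, hx'⟩ := exists_block_of_not_noBlock (hSU.sub_right (Commute.one_right _)) hm hSM
    hξm hb1 hb
  obtain ⟨y, hys, hyu, hyy, hdet⟩ := (stdHermitian τ hτ n).exists_normal_det_eq_pow hτ' hs
    (HermitianAdjoint.mul_adj_eq_one _ hs) hu (HermitianAdjoint.mul_adj_eq_one _ hu) hSU hm0 hSM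
    (minpoly.irreducible hint) hfb hb1 hi hx hx' (β := β)
  obtain ⟨g, hg, hgdet, hgc⟩ := HermitianAdjoint.exists_isometry_of_normal det_stdHermitian_adj
    (hdet ▸ pow_ne_zero i hβ) hyy
  exact ⟨g, hg, hgc s hs hys, hgc u hu hyu, hdet ▸ hgdet⟩

end Centralizer

section DeterminantOrder

lemma orderOf_mul_inv_pow_pow {A : Type*} [Group A] {γ : A} {q L m : ℕ} (hq : 2 ≤ q)
    (h : orderOf γ = q ^ 2 - 1) (hLm : L * m = q + 1) :
    orderOf ((γ * (γ ^ q)⁻¹) ^ m) = L := by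
  obtain ⟨r, rfl⟩ : ∃ r, q = r + 2 := ⟨q - 2, by omega⟩
  have hm : 0 < m := Nat.pos_of_ne_zero (by rintro rfl; simp at hLm)
  have h1 : γ * (γ ^ (r + 2))⁻¹ = (γ ^ (r + 1))⁻¹ := by group
  have h2 : (r + 2) ^ 2 - 1 = (r + 1) * m * L := by
    rw [mul_assoc, mul_comm m, hLm]
    exact Nat.sub_eq_of_eq_add (by ring)
  rw [h1, inv_pow, orderOf_inv, ← pow_mul, orderOf_pow_of_dvd (by positivity) (h ▸ h2 ▸ ⟨L, rfl⟩),
    h, h2, Nat.mul_div_cancel_left _ (by positivity)]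

end DeterminantOrder

/-- Equation (lconj) in the proof of Proposition 4.6 of the paper.
Let `ℓ` be a prime not dividing `q`, let `(q+1)_ℓ = ℓ^a` be the `ℓ`-part of `q + 1` (so that
`(q+1)_{ℓ'} = (q+1)/ℓ^a`), and let `R = {g ∈ GU_n(q) : det(g)^{(q+1)_{ℓ'}} = 1}`.  Let
`h = su = us ∈ GU_n(q)` have order coprime to `ℓ`, with `s` semisimple (order coprime to `p`)
and `u` unipotent.  For each eigenvalue `ξ` of `s` over an algebraic closure `K`, let `Λ ξ` be
the Jordan type of the restriction of `u` to `ker (s - ξ)`.  Then `s, u ∈ GU_n(q)`, `h ∈ R`,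
and `|h^{GU_n(q)}| = d₀ · |h^{R}|`, where `d₀` is the gcd of `(q+1)_ℓ` and all the parts of
all the `Λ ξ`. -/
theorem stmt13 {p q ℓ : ℕ} (hp : p.Prime) (hl : ℓ.Prime) (k₀ : ℕ) (hk₀ : 0 < k₀)
    (hq : q = p ^ k₀) (hlq : ¬ ℓ ∣ q)
    {n : ℕ} (hn : 2 ≤ n)
    (F2 : Type*) [Field F2] [Fintype F2] (hcard : Fintype.card F2 = q ^ 2)
    (K : Type*) [Field K] [IsAlgClosed K] [Algebra F2 K]
    (s u : GL (Fin n) F2)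
    (hGU : IsGU q (s * u))
    (hord : Nat.Coprime (orderOf (s * u)) ℓ)
    (hsu : s * u = u * s)
    (hs : Nat.Coprime (orderOf s) p)
    (hu : IsNilpotent ((u : Matrix (Fin n) (Fin n) F2) - 1))
    (Λ : K → Multiset ℕ)
    (hΛpos : ∀ ξ : K, (glToEnd (K := K) s).HasEigenvalue ξ → ∀ i ∈ Λ ξ, 0 < i)
    (hΛsum : ∀ ξ : K, (glToEnd (K := K) s).HasEigenvalue ξ →
      (Λ ξ).sum = finrank K ((glToEnd (K := K) s).eigenspace ξ))
    (hΛrank : ∀ ξ : K, (glToEnd (K := K) s).HasEigenvalue ξ → ∀ k : ℕ, 1 ≤ k →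
      ((Λ ξ).filter (fun i => k ≤ i)).card =
        finrank K (((glToEnd (K := K) s).eigenspace ξ).map ((glToEnd (K := K) u - 1) ^ (k - 1)))
          - finrank K (((glToEnd (K := K) s).eigenspace ξ).map ((glToEnd (K := K) u - 1) ^ k)))
    (d₀ : ℕ)
    (hd₀ : ∀ t : ℕ, t ∣ d₀ ↔ (t ∣ ℓ ^ ((q + 1).factorization ℓ) ∧
      ∀ ξ : K, (glToEnd (K := K) s).HasEigenvalue ξ → ∀ i ∈ Λ ξ, t ∣ i)) :
    IsGU q s ∧ IsGU q u ∧
    ((s * u : GL (Fin n) F2) : Matrix (Fin n) (Fin n) F2).det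
        ^ ((q + 1) / ℓ ^ ((q + 1).factorization ℓ)) = 1 ∧
    Set.ncard {x : GL (Fin n) F2 | ∃ g : GL (Fin n) F2, IsGU q g ∧ x = g * (s * u) * g⁻¹}
      = d₀ * Set.ncard {x : GL (Fin n) F2 | ∃ g : GL (Fin n) F2,
          (IsGU q g ∧ ((g : Matrix (Fin n) (Fin n) F2).det
            ^ ((q + 1) / ℓ ^ ((q + 1).factorization ℓ)) = 1)) ∧ x = g * (s * u) * g⁻¹} := by
  have hp' : Fact p.Prime := ⟨hp⟩
  have hn' : NeZero n := ⟨by omega⟩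
  have hq2 : 2 ≤ q := hq ▸ hp.two_le.trans (Nat.le_self_pow hk₀.ne' p)
  have hchar : CharP F2 p := charP_of_card_eq_prime_pow (f := k₀ * 2) (by rw [hcard, hq, pow_mul])
  have hcharK : CharP K p := charP_of_injective_algebraMap (algebraMap F2 K).injective p
  obtain ⟨τ, hτq⟩ : ∃ τ : F2 →+* F2, ∀ a, τ a = a ^ q :=
    ⟨iterateFrobenius F2 p k₀, fun a => by rw [iterateFrobenius_def, hq]⟩
  obtain ⟨φ, hφ⟩ : ∃ φ : K →+* K, ∀ a, φ a = a ^ q :=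
    ⟨iterateFrobenius K p k₀, fun a => by rw [iterateFrobenius_def, hq]⟩
  have hτ : ∀ a, τ (τ a) = a := fun a => by
    rw [hτq, hτq, ← pow_mul, ← sq, ← hcard, FiniteField.pow_card]
  obtain ⟨γ, hγ⟩ := IsCyclic.exists_ofOrder_eq_natCard (α := F2ˣ)
  rw [Nat.card_units, Nat.card_eq_fintype_card, hcard] at hγ
  have hτ' : ∃ a, τ a ≠ a := by
    refine ⟨γ, fun h => ?_⟩
    have h1 : γ ^ q = γ := Units.ext (by rw [Units.val_pow_eq_pow_val, ← hτq, h])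
    have h2 : γ ^ (q - 1) = 1 := by
      have h3 : γ ^ (q - 1) * γ = 1 * γ := by
        rw [← pow_succ, Nat.sub_add_cancel (by omega), h1, one_mul]
      exact mul_right_cancel h3
    have h3 := Nat.le_of_dvd (by omega) (hγ ▸ orderOf_dvd_of_pow_eq_one h2)
    have h4 : 2 * q ≤ q ^ 2 := by rw [sq]; exact Nat.mul_le_mul_right q hq2
    omega
  set 𝒢 := (stdHermitian τ hτ n).isometryGroup
  have hmem : ∀ g : GL (Fin n) F2, IsGU q g ↔ g ∈ 𝒢 := fun g => isGU_iff hτq g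
  set L := ℓ ^ (q + 1).factorization ℓ
  set m' := (q + 1) / L
  have hLdvd : L ∣ q + 1 := Nat.ordProj_dvd _ _
  have hLm : L * m' = q + 1 := Nat.mul_div_cancel' hLdvd
  obtain ⟨r, hr⟩ := exists_pow_prime_pow_eq_one hu
  have hcop : (orderOf s).Coprime (orderOf u) :=
    Nat.Coprime.coprime_dvd_right (orderOf_dvd_of_pow_eq_one hr) (hs.pow_right r)
  have hsz : s ∈ Subgroup.zpowers (s * u) := Commute.mem_zpowers_mul_of_coprime hsu hcop
  have huz : u ∈ Subgroup.zpowers (s * u) := by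
    have h := mul_mem (inv_mem hsz) (Subgroup.mem_zpowers (s * u))
    rwa [inv_mul_cancel_left] at h
  rw [hmem] at hGU
  have hle : Subgroup.zpowers (s * u) ≤ 𝒢 := Subgroup.zpowers_le.2 hGU
  have hs𝒢 := hle hsz
  have hu𝒢 := hle huz
  have hdet : ∀ g ∈ 𝒢, (g : Matrix (Fin n) (Fin n) F2).det ^ (q + 1) = 1 := fun g hg => by
    have h := congrArg LinearMap.det (HermitianAdjoint.mem_isometryGroup.1 hg)
    rwa [map_mul, det_stdHermitian_adj, LinearMap.det_toLin', map_one, hτq, ← pow_succ] at h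
  have hsm : s ^ orderOf s = 1 := pow_orderOf_eq_one s
  have hmK : ((orderOf s : ℕ) : K) ≠ 0 := by
    rw [Ne, CharP.cast_eq_zero_iff K p]
    exact fun h => hp.one_lt.ne' (Nat.eq_one_of_dvd_coprimes hs h dvd_rfl)
  have hmF : ((orderOf s : ℕ) : F2) ≠ 0 := by
    rw [Ne, CharP.cast_eq_zero_iff F2 p]
    exact fun h => hp.one_lt.ne' (Nat.eq_one_of_dvd_coprimes hs h dvd_rfl)
  obtain ⟨hd₀L, hd₀Λ⟩ := (hd₀ d₀).1 dvd_rfl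
  have hd₀pos : 0 < d₀ := Nat.pos_of_dvd_of_pos hd₀L (pow_pos hl.pos _)
  have hSN : Commute (glToEnd (K := K) s) (glToEnd (K := K) u - 1) :=
    (commute_glToEnd hsu).sub_right (Commute.one_right _)
  have hmemΛ : ∀ ξ, (glToEnd (K := K) s).HasEigenvalue ξ → ∀ k, 1 ≤ k → (k ∈ Λ ξ ↔
      ¬ NoBlock (glToEnd (K := K) u - 1) ((glToEnd (K := K) s).eigenspace ξ) k) :=
    fun ξ hξ k hk => mem_iff_not_noBlock (mem_eigenspace_of_commute hSN ξ) (hΛrank ξ hξ) hk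
  let ψ : GL (Fin n) F2 →* F2ˣ := (powMonoidHom m').comp Matrix.GeneralLinearGroup.det
  have hψ : ∀ g, ((ψ g : F2ˣ) : F2) = (g : Matrix (Fin n) (Fin n) F2).det ^ m' := fun g => rfl
  have hψL : ∀ g ∈ 𝒢, ψ g ^ L = 1 := fun g hg => Units.ext (by
    rw [Units.val_pow_eq_pow_val, hψ, ← pow_mul, mul_comm, hLm, hdet g hg, Units.val_one])
  have hω := orderOf_mul_inv_pow_pow hq2 hγ hLm
  set ω := (γ * (γ ^ q)⁻¹) ^ m'
  have hψω : ∀ (g : GL (Fin n) F2) (i : ℕ),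
      (g : Matrix (Fin n) (Fin n) F2).det * τ ((γ : F2) ^ i) = (γ : F2) ^ i → ψ g = ω ^ i := by
    intro g i hg
    have h1 : Matrix.GeneralLinearGroup.det g * (γ ^ q) ^ i = γ ^ i := Units.ext (by
      rw [map_pow, hτq] at hg
      simpa using hg)
    have h2 : Matrix.GeneralLinearGroup.det g = (γ * (γ ^ q)⁻¹) ^ i := by
      rw [mul_pow, inv_pow]
      exact eq_mul_inv_of_mul_eq h1
    change Matrix.GeneralLinearGroup.det g ^ m' = ((γ * (γ ^ q)⁻¹) ^ m') ^ i
    rw [h2, pow_right_comm]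
  have hcardG : Nat.card (𝒢.map ψ) = L := by
    rw [← mul_one (Nat.card _)]
    refine card_mul_eq_of_cyclic hω (one_dvd L) ?_ {1} (fun t _ ht => ht 1 rfl) ?_
    · rintro _ ⟨g, hg, rfl⟩
      rw [Nat.div_one]
      exact hψL g hg
    · rintro i rfl
      obtain ⟨y, hyy, hy⟩ := exists_normal_det_eq (τ := τ) (hτ := hτ) (n := n) (γ : F2)
      obtain ⟨g, hg, hgdet, -⟩ := HermitianAdjoint.exists_isometry_of_normal det_stdHermitian_adj
        (hy ▸ γ.ne_zero) hyy
      exact ⟨g, hg, hψω g 1 (by rw [pow_one, ← hy, hgdet])⟩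
  have hcomm : ∀ {g : GL (Fin n) F2}, Commute g s → Commute g u →
      g ∈ Subgroup.centralizer {s * u} := fun hgs hgu =>
    Subgroup.mem_centralizer_singleton_iff.2 (hgs.mul_right hgu).eq
  have hcardC : Nat.card ((𝒢 ⊓ Subgroup.centralizer {s * u}).map ψ) * d₀ = L := by
    refine card_mul_eq_of_cyclic hω hd₀L ?_
      {i | ∃ ξ, (glToEnd (K := K) s).HasEigenvalue ξ ∧ i ∈ Λ ξ}
      (fun t htL ht => (hd₀ t).2 ⟨htL, fun ξ hξ i hi => ht i ⟨ξ, hξ, hi⟩⟩) ?_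
    · rintro _ ⟨g, ⟨hg, hgc⟩, rfl⟩
      have hgu : Commute g u := by
        obtain ⟨k, hk⟩ := huz
        rw [← hk]
        exact Commute.zpow_right (Subgroup.mem_centralizer_singleton_iff.1 hgc) k
      have hg' : w0Mat n F2 * ((g : Matrix (Fin n) (Fin n) F2).map τ)ᵀ * w0Mat n F2 * g = 1 := by
        have h := HermitianAdjoint.mem_isometryGroup.1 hg
        rw [stdHermitian_adj_toLin', Module.End.mul_eq_comp, ← Matrix.toLin'_mul] at h
        exact Matrix.toLin'.injective (h.trans Matrix.toLin'_one.symm)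
      have h := det_pow_eq_one_of_commute hτq hφ hmK hsm hsu hu hgu hg' hd₀pos
        (hd₀L.trans hLdvd) (fun k hk ξ hξ => by
          by_contra hcon
          have hk1 : 1 ≤ k := Nat.pos_of_ne_zero (by rintro rfl; exact hk (dvd_zero _))
          exact hk (hd₀Λ ξ hξ k ((hmemΛ ξ hξ k hk1).2 hcon)))
      refine Units.ext ?_
      rw [Units.val_pow_eq_pow_val, hψ, ← pow_mul, Units.val_one,
        ← Nat.mul_div_assoc _ hd₀L, mul_comm m', hLm, h]
    · rintro i ⟨ξ, hξ, hi⟩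
      have hi0 := hΛpos ξ hξ i hi
      obtain ⟨g, hg, hgs, hgu, hgdet⟩ := exists_isometry_det_of_block hτ' hs𝒢 hu𝒢 hsu hmF hsm hξ
        hi0 ((hmemΛ ξ hξ i hi0).1 hi) γ.ne_zero
      exact ⟨g, ⟨hg, hcomm hgs hgu⟩, hψω g i hgdet⟩
  have hker : ∀ g, g ∈ ψ.ker ↔ (g : Matrix (Fin n) (Fin n) F2).det ^ m' = 1 := fun g => by
    rw [MonoidHom.mem_ker, ← hψ, Units.val_eq_one]
  refine ⟨(hmem s).2 hs𝒢, (hmem u).2 hu𝒢, ?_, ?_⟩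
  · rw [← hker, MonoidHom.mem_ker, ← orderOf_eq_one_iff]
    refine Nat.eq_one_of_dvd_coprimes (hord.pow_right ((q + 1).factorization ℓ))
      (orderOf_map_dvd ψ _) (orderOf_dvd_of_pow_eq_one (hψL _ hGU))
  · have h := ncard_conj_eq_mul ψ 𝒢 (s * u) hcardG hcardC
    simpa only [hmem, ← hker, Subgroup.mem_inf] using h
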